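/- Smoothness of univariate PN subdivision (Theorem 2): let a : ℤ → ℝ be a finitely supported mask whose symbol factors as a(z) = ((1+z)/2)^m b(z) for a finitely supported mask b : ℤ → ℝ (i.e. a_i = 2^{−m} Σ_{r=0}^{m} binom(m,r) b_{i−r}), and assume the linear scheme S_b is convergent (C⁰), i.e. for every bounded f⁰ : ℤ → ℝ^d there exists a continuous F : ℝ → ℝ^d with lim_{k→∞} sup_i ‖(S_b^k f⁰)_i − F(2^{−k} i)‖ = 0. Let n^k : ℤ → ℝ^d (k ∈ ℕ) be sequences of unit vectors with ⟨n_i^{k+1}, n_j^k⟩ ≥ 0 whenever a_{i−2j} ≠ 0, set A_{ij}^k = A(n_i^{k+1}, n_j^k), and assume there are constants c_s > 0, 0 < γ < 1 such that for all s₁, s₂ ≥ 0 with s₁ + s₂ ≤ m, all i, j ∈ ℤ, all l with a_{i−2l} ≠ 0 and all k ∈ ℕ: ‖Δ₁^{s₁} Δ₂^{s₂} (A_{ij}^k − A_{il}^k)‖ ≤ c_s 2^{−(s₁+s₂)k} γ^k. Define M_{ij}^k = I + Σ_{l∈ℤ} a_{i−2l}(A_{ij}^k − A_{il}^k). Then for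 every bounded initial sequence p⁰ : ℤ → ℝ^d, the PN subdivision sequence p_i^{k+1} = Σ_{j∈ℤ} a_{i−2j} M_{ij}^k p_j^k converges to a C^m limit: there exists an m-times continuously differentiable P : ℝ → ℝ^d with lim_{k→∞} sup_{i∈ℤ} ‖p_i^k − P(2^{−k} i)‖ = 0. -/

import Mathlib

open scoped RealInnerProductSpace BigOperators

noncomputable section

variable {d : ℕ}

/-- The projection map `A(X₁, X₂) : v ↦ (⟨X₁ + X₂, v⟩ / ⟨X₁ + X₂, X₁⟩) · X₁`. -/
def Amap (X₁ X₂ : EuclideanSpace ℝ (Fin d)) :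
    EuclideanSpace ℝ (Fin d) →L[ℝ] EuclideanSpace ℝ (Fin d) :=
  (⟪X₁ + X₂, X₁⟫)⁻¹ • (innerSL ℝ (X₁ + X₂)).smulRight X₁

/-- `A_{ij}^k = A(n_i^{k+1}, n_j^k)` for the subdivided normals `n^k`. -/
def pnA (n : ℕ → ℤ → EuclideanSpace ℝ (Fin d)) (k : ℕ) (i j : ℤ) :
    EuclideanSpace ℝ (Fin d) →L[ℝ] EuclideanSpace ℝ (Fin d) :=
  Amap (n (k + 1) i) (n k j)

/-- The PN perturbation matrices `M_{ij}^k = I + Σ_l a_{i-2l}(A_{ij}^k − A_{il}^k)`. -/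
def pnM (a : ℤ → ℝ) (n : ℕ → ℤ → EuclideanSpace ℝ (Fin d)) (k : ℕ) (i j : ℤ) :
    EuclideanSpace ℝ (Fin d) →L[ℝ] EuclideanSpace ℝ (Fin d) :=
  1 + ∑ᶠ l : ℤ, a (i - 2 * l) • (pnA n k i j - pnA n k i l)

/-- Backward partial difference in the first index: `(Δ₁ X)_{ij} = X_{ij} − X_{i-1,j}`. -/
def D1 {L : Type*} [AddCommGroup L] (X : ℤ → ℤ → L) : ℤ → ℤ → L :=
  fun i j => X i j - X (i - 1) j

/-- Backward partial difference in the second index: `(Δ₂ X)_{ij} = X_{ij} − X_{i,j-1}`. -/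
def D2 {L : Type*} [AddCommGroup L] (X : ℤ → ℤ → L) : ℤ → ℤ → L :=
  fun i j => X i j - X i (j - 1)

/-- The linear subdivision operator `(S_b p)_i = Σ_j b_{i−2j} p_j`. -/
def Sop (b : ℤ → ℝ) (p : ℤ → EuclideanSpace ℝ (Fin d)) : ℤ → EuclideanSpace ℝ (Fin d) :=
  fun i => ∑ᶠ j : ℤ, b (i - 2 * j) • p j

namespace PNSubdivision

open Filter Topology

section WeightedSums

variable {V : Type*} [NormedAddCommGroup V]

/-- The backward difference of a sequence. -/
def bdiff (f : ℤ → V) : ℤ → V := fun i => f i - f (i - 1)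

theorem bdiff_add (f g : ℤ → V) : bdiff (f + g) = bdiff f + bdiff g := by
  funext i
  simp only [bdiff, Pi.add_apply]
  abel

theorem iterate_bdiff_add (s : ℕ) (f g : ℤ → V) :
    bdiff^[s] (f + g) = bdiff^[s] f + bdiff^[s] g := by
  induction s generalizing f g with
  | zero => rfl
  | succ s ih => simp only [Function.iterate_succ_apply, bdiff_add, ih]

theorem norm_iterate_bdiff_le {C : ℝ} (s : ℕ) {f : ℤ → V} (hf : ∀ i, ‖f i‖ ≤ C) (i : ℤ) :
    ‖bdiff^[s] f i‖ ≤ 2 ^ s * C := by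
  induction s generalizing i with
  | zero => simpa using hf i
  | succ s ih =>
    rw [Function.iterate_succ_apply', bdiff, pow_succ]
    linarith [norm_sub_le (bdiff^[s] f i) (bdiff^[s] f (i - 1)), ih i, ih (i - 1)]

variable [NormedSpace ℝ V]

theorem support_dilate_subset {κ : ℤ → ℝ} {c N : ℤ} (hc : 0 < c)
    (hκ : ∀ t, c * N < |t| → κ t = 0) (f : ℤ → V) (i : ℤ) :
    (Function.support fun l => κ (i - c * l) • f l) ⊆
      (Finset.Icc (i / c - N) (i / c + N) : Finset ℤ) := by
  intro l hl
  have h : |i - c * l| ≤ c * N := by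
    by_contra! h
    exact hl (by simp [hκ _ h])
  rw [abs_le] at h
  rw [Finset.coe_Icc, Set.mem_Icc]
  constructor
  · have : i / c ≤ l + N := by
      have := Int.ediv_le_ediv hc (show i ≤ c * (l + N) by linarith)
      rwa [Int.mul_ediv_cancel_left _ hc.ne'] at this
    linarith
  · have : l - N ≤ i / c := by
      have := Int.ediv_le_ediv hc (show c * (l - N) ≤ i by linarith)
      rwa [Int.mul_ediv_cancel_left _ hc.ne'] at this
    linarith

theorem finite_support_dilate {κ : ℤ → ℝ} {c N : ℤ} (hc : 0 < c)
    (hκ : ∀ t, c * N < |t| → κ t = 0) (f : ℤ → V) (i : ℤ) :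
    (Function.support fun l => κ (i - c * l) • f l).Finite :=
  (Finset.finite_toSet _).subset (support_dilate_subset hc hκ f i)

theorem norm_finsum_dilate_le {κ : ℤ → ℝ} {c : ℤ} {N : ℕ} (hc : 0 < c)
    (hκ : ∀ t, c * N < |t| → κ t = 0) {B C : ℝ} (hB : ∀ t, |κ t| ≤ B) {f : ℤ → V}
    (hC : ∀ l, ‖f l‖ ≤ C) (i : ℤ) :
    ‖∑ᶠ l, κ (i - c * l) • f l‖ ≤ (2 * N + 1) * B * C := by
  rw [finsum_eq_sum_of_support_subset _ (support_dilate_subset hc hκ f i)]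
  have hB0 : 0 ≤ B := (abs_nonneg _).trans (hB 0)
  refine (norm_sum_le_of_le (n := fun _ => B * C) _ fun l _ => ?_).trans ?_
  · rw [norm_smul]
    exact mul_le_mul (hB _) (hC l) (norm_nonneg _) hB0
  · rw [Finset.sum_const, Int.card_Icc, nsmul_eq_mul,
      show (i / c + N + 1 - (i / c - N)).toNat = 2 * N + 1 by omega]
    push_cast
    exact (mul_assoc _ _ _).ge

/-- The subdivision operator with mask `β`, for sequences in an arbitrary real vector space. -/
def subdiv (β : ℤ → ℝ) (f : ℤ → V) : ℤ → V :=
  fun i => ∑ᶠ j : ℤ, β (i - 2 * j) • f j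

/-- The mask whose symbol is `(1 + z) / 2` times that of `β`. -/
def avgMask (β : ℤ → ℝ) : ℤ → ℝ := fun i => (2 : ℝ)⁻¹ * (β i + β (i - 1))

/-- `kernel β k` is the result of `k` subdivision steps applied to the unit impulse. -/
def kernel (β : ℤ → ℝ) : ℕ → ℤ → ℝ
  | 0 => fun i => if i = 0 then 1 else 0
  | k + 1 => subdiv β (kernel β k)

/-- The mask `β` is supported in `[-N, N]`. -/
def SuppIn (β : ℤ → ℝ) (N : ℕ) : Prop := ∀ t : ℤ, (N : ℤ) < |t| → β t = 0

variable {β : ℤ → ℝ} {N : ℕ}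

theorem SuppIn.two_mul (hβ : SuppIn β N) (t : ℤ) (ht : 2 * (N : ℤ) < |t|) : β t = 0 :=
  hβ t (by omega)

theorem SuppIn.finite (hβ : SuppIn β N) (f : ℤ → V) (i : ℤ) :
    (Function.support fun l => β (i - 2 * l) • f l).Finite :=
  finite_support_dilate two_pos hβ.two_mul f i

theorem SuppIn.avg (hβ : SuppIn β N) : SuppIn (avgMask β) (N + 1) := by
  intro t ht
  push_cast at ht
  rw [avgMask, hβ t (by omega), hβ (t - 1) (by rw [lt_abs] at *; omega)]
  simp

theorem SuppIn.exists_bound (hβ : SuppIn β N) : ∃ B : ℝ, 0 ≤ B ∧ ∀ t, |β t| ≤ B := by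
  refine ⟨∑ t ∈ Finset.Icc (-(N : ℤ)) N, |β t|, Finset.sum_nonneg fun _ _ => abs_nonneg _,
    fun t => ?_⟩
  by_cases ht : (N : ℤ) < |t|
  · rw [hβ t ht, abs_zero]
    exact Finset.sum_nonneg fun _ _ => abs_nonneg _
  · refine Finset.single_le_sum (f := fun t => |β t|) (fun _ _ => abs_nonneg _) ?_
    rw [Finset.mem_Icc]
    exact abs_le.1 (not_lt.1 ht)

theorem SuppIn.norm_subdiv_le (hβ : SuppIn β N) {B C : ℝ} (hB : ∀ t, |β t| ≤ B) {f : ℤ → V}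
    (hC : ∀ l, ‖f l‖ ≤ C) (i : ℤ) : ‖subdiv β f i‖ ≤ (2 * N + 1) * B * C :=
  norm_finsum_dilate_le two_pos hβ.two_mul hB hC i

theorem SuppIn.subdiv_sub (hβ : SuppIn β N) (f g : ℤ → V) :
    subdiv β (f - g) = subdiv β f - subdiv β g := by
  funext i
  simp only [subdiv, Pi.sub_apply, smul_sub]
  exact finsum_sub_distrib (hβ.finite f i) (hβ.finite g i)

theorem subdiv_smul (β : ℤ → ℝ) (c : ℝ) (f : ℤ → V) :
    subdiv β (c • f) = c • subdiv β f := by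
  funext i
  simp only [subdiv, Pi.smul_apply, smul_finsum, smul_comm c]

theorem SuppIn.iterate_subdiv_sub (hβ : SuppIn β N) (k : ℕ) (f g : ℤ → V) :
    (subdiv β)^[k] (f - g) = (subdiv β)^[k] f - (subdiv β)^[k] g := by
  induction k generalizing f g with
  | zero => rfl
  | succ k ih => rw [Function.iterate_succ_apply, hβ.subdiv_sub, ih]; rfl

theorem subdiv_shift (β : ℤ → ℝ) (f : ℤ → V) (c i : ℤ) :
    subdiv β (fun j => f (j - c)) i = subdiv β f (i - 2 * c) := by
  simp only [subdiv]
  rw [← finsum_comp_equiv (Equiv.addRight c)]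
  refine finsum_congr fun j => ?_
  simp only [Equiv.coe_addRight, add_sub_cancel_right]
  congr 2
  ring

/-- A weighted sum with an averaged mask, shifted by one, telescopes. -/
theorem SuppIn.finsum_avgMask_sub (hβ : SuppIn β N) (g : ℤ → V) (i : ℤ) :
    (∑ᶠ l, avgMask β (i - 2 * l) • g l) - ∑ᶠ l, avgMask β (i - 1 - 2 * l) • g l =
      (2 : ℝ)⁻¹ • ∑ᶠ l, β (i - 2 * l) • (g l - g (l - 1)) := by
  have h1 : ∑ᶠ l, β (i - 2 * l) • (g l - g (l - 1)) =
      (∑ᶠ l, β (i - 2 * l) • g l) - ∑ᶠ l, β (i - 2 - 2 * l) • g l := by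
    have := subdiv_shift β g 1 i
    simp only [subdiv, mul_one] at this
    rw [← this, ← finsum_sub_distrib (hβ.finite g i) (hβ.finite (fun l => g (l - 1)) i)]
    simp only [smul_sub]
  rw [h1, ← finsum_sub_distrib (hβ.avg.finite g i) (hβ.avg.finite g (i - 1)),
    ← finsum_sub_distrib (hβ.finite g i) (hβ.finite g (i - 2)), smul_finsum]
  refine finsum_congr fun l => ?_
  rw [← sub_smul, ← sub_smul, smul_smul]
  congr 1
  simp only [avgMask]
  rw [show i - 1 - 2 * l - 1 = i - 2 - 2 * l by ring, show i - 2 * l - 1 = i - 1 - 2 * l by ring]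
  ring

theorem SuppIn.bdiff_subdiv_avgMask (hβ : SuppIn β N) (f : ℤ → V) :
    bdiff (subdiv (avgMask β) f) = (2 : ℝ)⁻¹ • subdiv β (bdiff f) := by
  funext i
  exact hβ.finsum_avgMask_sub f i

theorem bdiff_smul (c : ℝ) (f : ℤ → V) : bdiff (c • f) = c • bdiff f := by
  funext i
  simp [bdiff, smul_sub]

theorem iterate_bdiff_smul (s : ℕ) (c : ℝ) (f : ℤ → V) :
    bdiff^[s] (c • f) = c • bdiff^[s] f := by
  induction s generalizing f with
  | zero => rfl
  | succ s ih => simp only [Function.iterate_succ_apply, bdiff_smul, ih]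

theorem SuppIn.iterate_avgMask (hβ : SuppIn β N) (r : ℕ) :
    SuppIn (avgMask^[r] β) (N + r) := by
  induction r with
  | zero => exact hβ
  | succ r ih => rw [Function.iterate_succ_apply']; exact ih.avg

theorem SuppIn.iterate_bdiff_subdiv (hβ : SuppIn β N) (r s : ℕ) (f : ℤ → V) :
    bdiff^[s] (subdiv (avgMask^[r + s] β) f) =
      ((2 : ℝ)⁻¹ ^ s) • subdiv (avgMask^[r] β) (bdiff^[s] f) := by
  induction s generalizing f with
  | zero => simp
  | succ s ih =>
    rw [← add_assoc, Function.iterate_succ_apply, Function.iterate_succ_apply',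
      (hβ.iterate_avgMask (r + s)).bdiff_subdiv_avgMask, iterate_bdiff_smul, ih, smul_smul,
      Function.iterate_succ_apply, pow_succ']

theorem iterate_avgMask_apply (β : ℤ → ℝ) (m : ℕ) (i : ℤ) :
    avgMask^[m] β i = (2 : ℝ)⁻¹ ^ m *
      ∑ r ∈ Finset.range (m + 1), (m.choose r : ℝ) * β (i - (r : ℤ)) := by
  induction m generalizing i with
  | zero => simp
  | succ m ih =>
    have h := Finset.sum_choose_succ_mul (fun r _ => β (i - (r : ℤ))) m
    rw [h, Function.iterate_succ_apply', avgMask, ih, ih, pow_succ]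
    simp only [Nat.cast_add, Nat.cast_one, sub_sub, add_comm (1 : ℤ)]
    ring

end WeightedSums

section Kernel

variable {V : Type*} [NormedAddCommGroup V] [NormedSpace ℝ V] {β : ℤ → ℝ} {N : ℕ}

theorem SuppIn.kernel_eq_zero (hβ : SuppIn β N) (k : ℕ) (i : ℤ)
    (hi : (N : ℤ) * 2 ^ k < |i| + N) : kernel β k i = 0 := by
  induction k generalizing i with
  | zero =>
    have : i ≠ 0 := by rintro rfl; simp at hi
    simp [kernel, this]
  | succ k ih =>
    rw [kernel, subdiv]
    refine finsum_eq_zero_of_forall_eq_zero fun j => ?_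
    by_cases hj : (N : ℤ) * 2 ^ k < |j| + N
    · rw [ih j hj, smul_zero]
    · rw [hβ (i - 2 * j), zero_smul]
      have h1 : |i| ≤ |i - 2 * j| + 2 * |j| := by
        have := abs_add_le (i - 2 * j) (2 * j)
        rwa [sub_add_cancel, abs_mul, abs_two] at this
      rw [pow_succ] at hi
      linarith

theorem SuppIn.kernel_eq_zero' (hβ : SuppIn β N) (k : ℕ) (t : ℤ)
    (ht : 2 ^ k * (N : ℤ) < |t|) : kernel β k t = 0 :=
  hβ.kernel_eq_zero k t (by rw [mul_comm]; omega)

theorem SuppIn.iterate_subdiv_apply (hβ : SuppIn β N) (k : ℕ) (f : ℤ → V) (i : ℤ) :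
    (subdiv β)^[k] f i = ∑ᶠ l, kernel β k (i - 2 ^ k * l) • f l := by
  induction k generalizing i with
  | zero =>
    rw [finsum_eq_single _ i]
    · simp [kernel]
    · intro l hl
      simp [kernel, sub_eq_zero, hl.symm]
  | succ k ih =>
    have h2 : (0 : ℤ) < 2 ^ k := by positivity
    have hker : ∀ l, kernel β (k + 1) (i - 2 ^ (k + 1) * l) =
        ∑ᶠ j, β (i - 2 * j) * kernel β k (j - 2 ^ k * l) := fun l => by
      have := subdiv_shift β (kernel β k) (2 ^ k * l) i
      rw [pow_succ', mul_assoc, kernel, ← this]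
      rfl
    rw [Function.iterate_succ_apply', subdiv]
    simp only [ih, hker, smul_finsum, finsum_smul, smul_smul]
    have hfin : (Function.support fun x : ℤ × ℤ =>
        (β (i - 2 * x.1) * kernel β k (x.1 - 2 ^ k * x.2)) • f x.2).Finite := by
      have h := (hβ.finite (fun _ => (1 : ℝ)) i).biUnion fun j _ =>
        (finite_support_dilate h2 (hβ.kernel_eq_zero' k) f j).image (Prod.mk j)
      refine h.subset fun x hx => ?_
      rw [Function.mem_support, mul_smul] at hx
      simp only [Set.mem_iUnion, Set.mem_image, Function.mem_support]
      refine ⟨x.1, fun h0 => hx ?_, x.2, fun h0 => hx ?_, rfl⟩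
      · rw [smul_eq_mul, mul_one] at h0
        rw [h0, zero_smul]
      · rw [h0, smul_zero]
    have h1 := finsum_curry _ hfin
    have h3 := finsum_curry (fun x : ℤ × ℤ =>
        (β (i - 2 * x.2) * kernel β k (x.2 - 2 ^ k * x.1)) • f x.1)
        (hfin.preimage (Equiv.prodComm ℤ ℤ).injective.injOn)
    rw [← h1, ← h3]
    exact (finsum_comp_equiv (Equiv.prodComm ℤ ℤ)).symm

end Kernel

section UniformConvergence

variable {V : Type*} [NormedAddCommGroup V]

/-- The sequences `u k`, regarded as samples on the grid `2⁻ᵏ ℤ`, converge uniformly to `U`. -/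
def UConv (u : ℕ → ℤ → V) (U : ℝ → V) : Prop :=
  ∀ ε > (0 : ℝ), ∃ K : ℕ, ∀ k ≥ K, ∀ i : ℤ, ‖u k i - U ((i : ℝ) / 2 ^ k)‖ ≤ ε

theorem tendsto_floor_div_two_pow (x : ℝ) :
    Tendsto (fun k : ℕ => (⌊x * 2 ^ k⌋ : ℝ) / 2 ^ k) atTop (𝓝 x) := by
  have h : Tendsto (fun k : ℕ => x - (2 : ℝ)⁻¹ ^ k) atTop (𝓝 x) := by
    simpa using tendsto_const_nhds.sub
      (tendsto_pow_atTop_nhds_zero_of_lt_one (r := (2 : ℝ)⁻¹) (by norm_num) (by norm_num))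
  refine tendsto_of_tendsto_of_tendsto_of_le_of_le h tendsto_const_nhds (fun k => ?_) fun k => ?_
  · have h2 : (0 : ℝ) < 2 ^ k := by positivity
    have := Int.lt_floor_add_one (x * 2 ^ k)
    rw [le_div_iff₀ h2, sub_mul, ← mul_pow]
    norm_num
    linarith
  · exact (div_le_iff₀ (by positivity)).2 (Int.floor_le _)

theorem UConv.tendsto {u : ℕ → ℤ → V} {U : ℝ → V} (h : UConv u U) (hU : Continuous U) (x : ℝ) :
    Tendsto (fun k => u k ⌊x * 2 ^ k⌋) atTop (𝓝 (U x)) := by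
  have h1 := (hU.tendsto x).comp (tendsto_floor_div_two_pow x)
  have h2 : Tendsto (fun k : ℕ => u k ⌊x * 2 ^ k⌋ - U ((⌊x * 2 ^ k⌋ : ℝ) / 2 ^ k)) atTop (𝓝 0) := by
    rw [Metric.tendsto_atTop]
    intro ε hε
    obtain ⟨K, hK⟩ := h (ε / 2) (by positivity)
    exact ⟨K, fun k hk => by rw [dist_zero_right]; linarith [hK k hk ⌊x * 2 ^ k⌋]⟩
  simpa using h2.add h1

/-- A sequence that is asymptotically close to samples of continuous functions converges
uniformly to a continuous function. -/
theorem exists_uconv_of_approx [CompleteSpace V] {u : ℕ → ℤ → V}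
    (h : ∀ ε > (0 : ℝ), ∃ G : ℝ → V, Continuous G ∧ ∃ K : ℕ, ∀ k ≥ K, ∀ i : ℤ,
      ‖u k i - G ((i : ℝ) / 2 ^ k)‖ ≤ ε) :
    ∃ U : ℝ → V, Continuous U ∧ UConv u U := by
  have hlim : ∀ x : ℝ, ∃ y, Tendsto (fun k => u k ⌊x * 2 ^ k⌋) atTop (𝓝 y) := by
    intro x
    refine cauchySeq_tendsto_of_complete (Metric.cauchySeq_iff'.2 fun ε hε => ?_)
    obtain ⟨G, hG, K, hK⟩ := h (ε / 5) (by positivity)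
    have h1 := (hG.tendsto x).comp (tendsto_floor_div_two_pow x)
    obtain ⟨K', hK'⟩ := Metric.tendsto_atTop.1 h1 (ε / 5) (by positivity)
    refine ⟨max K K', fun k hk => ?_⟩
    have hd : ∀ k ≥ max K K', dist (u k ⌊x * 2 ^ k⌋) (G x) ≤ 2 * (ε / 5) := fun k hk => by
      have h2 := hK k ((le_max_left _ _).trans hk) ⌊x * 2 ^ k⌋
      have h3 := hK' k ((le_max_right _ _).trans hk)
      rw [← dist_eq_norm] at h2
      refine (dist_triangle _ (G ((⌊x * 2 ^ k⌋ : ℝ) / 2 ^ k)) _).trans ?_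
      simp only [Function.comp_apply] at h3
      linarith
    have := dist_triangle_right (u k ⌊x * 2 ^ k⌋) (u (max K K') ⌊x * 2 ^ max K K'⌋) (G x)
    linarith [hd k hk, hd _ le_rfl]
  choose U hU using hlim
  have hUG : ∀ ε > (0 : ℝ), ∀ G : ℝ → V, Continuous G → ∀ K : ℕ, (∀ k ≥ K, ∀ i : ℤ,
      ‖u k i - G ((i : ℝ) / 2 ^ k)‖ ≤ ε) → ∀ x, ‖U x - G x‖ ≤ ε := by
    intro ε hε G hG K hK x
    refine le_of_tendsto ((hU x).sub ((hG.tendsto x).comp (tendsto_floor_div_two_pow x))).norm ?_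
    filter_upwards [eventually_ge_atTop K] with k hk
    exact hK k hk _
  refine ⟨U, continuous_of_uniform_approx_of_continuous fun s hs => ?_, fun ε hε => ?_⟩
  · obtain ⟨ε, hε, hs⟩ := Metric.mem_uniformity_dist.1 hs
    obtain ⟨G, hG, K, hK⟩ := h (ε / 2) (by positivity)
    refine ⟨G, hG, fun y => hs ?_⟩
    rw [dist_eq_norm]
    linarith [hUG _ (by positivity) G hG K hK y]
  · obtain ⟨G, hG, K, hK⟩ := h (ε / 2) (by positivity)
    refine ⟨K, fun k hk i => ?_⟩
    have h1 := hUG _ (by positivity) G hG K hK ((i : ℝ) / 2 ^ k)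
    have h2 := norm_sub_le_norm_sub_add_norm_sub (u k i) (G ((i : ℝ) / 2 ^ k))
      (U ((i : ℝ) / 2 ^ k))
    rw [norm_sub_rev (G _)] at h2
    linarith [hK k hk i]

theorem norm_sub_le_of_step {g : ℤ → V} {η : ℝ} {j i : ℤ} (hji : j ≤ i)
    (hg : ∀ t, j < t → t ≤ i → ‖g t - g (t - 1)‖ ≤ η) : ‖g i - g j‖ ≤ η * (i - j) := by
  induction i, hji using Int.leInduction with
  | base => simp
  | succ i hji ih =>
    have h1 := ih fun t h1 h2 => hg t h1 (by omega)
    have h2 := hg (i + 1) (by omega) le_rfl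
    rw [add_sub_cancel_right] at h2
    have h3 := norm_sub_le_norm_sub_add_norm_sub (g (i + 1)) (g i) (g j)
    push_cast
    linarith

theorem UConv.hasDerivAt [NormedSpace ℝ V] {u v : ℕ → ℤ → V} {U W : ℝ → V}
    (hu : UConv u U) (hU : Continuous U) (hv : UConv v W) (hW : Continuous W)
    (huv : ∀ k i, v k i = (2 : ℝ) ^ k • (u k i - u k (i - 1))) (x₀ : ℝ) :
    HasDerivAt U (W x₀) x₀ := by
  have key : ∀ ε > (0 : ℝ), ∃ δ > (0 : ℝ), ∀ x y, y ≤ x → |x - x₀| < δ → |y - x₀| < δ →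
      ‖(U x - U y) - (x - y) • W x₀‖ ≤ ε * (x - y) := by
    intro ε hε
    obtain ⟨δ, hδ, hδW⟩ := Metric.continuousAt_iff.1 hW.continuousAt (ε / 2) (by positivity)
    obtain ⟨K, hK⟩ := hv (ε / 2) (by positivity)
    refine ⟨δ, hδ, fun x y hyx hx hy => ?_⟩
    have h1 := ((hu.tendsto hU x).sub (hu.tendsto hU y)).sub
      (((tendsto_floor_div_two_pow x).sub (tendsto_floor_div_two_pow y)).smul_const (W x₀))
    refine le_of_tendsto_of_tendsto h1.norm
      (((tendsto_floor_div_two_pow x).sub (tendsto_floor_div_two_pow y)).const_mul ε) ?_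
    filter_upwards [eventually_ge_atTop K] with k hk
    have h2 : (0 : ℝ) < 2 ^ k := by positivity
    have hle : ⌊y * 2 ^ k⌋ ≤ ⌊x * 2 ^ k⌋ := Int.floor_le_floor (by gcongr)
    have hstep := norm_sub_le_of_step (g := fun t => u k t - ((t : ℝ) / 2 ^ k) • W x₀)
      (η := ε / 2 ^ k) hle fun t ht1 ht2 => ?_
    · refine (le_of_eq ?_).trans (hstep.trans (le_of_eq ?_))
      · congr 1
        rw [sub_smul]
        abel
      · ring
    · have hty : y < (t : ℝ) / 2 ^ k := by
        rw [lt_div_iff₀ h2]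
        exact Int.floor_lt.1 ht1
      have htx : (t : ℝ) / 2 ^ k ≤ x := by
        rw [div_le_iff₀ h2]
        exact Int.le_floor.1 ht2
      have hW' : ‖W ((t : ℝ) / 2 ^ k) - W x₀‖ ≤ ε / 2 := by
        rw [← dist_eq_norm]
        refine (hδW ?_).le
        rw [Real.dist_eq]
        rw [abs_lt] at *
        constructor <;> linarith
      have hv' : ‖v k t - W x₀‖ ≤ ε := by
        have := norm_sub_le_norm_sub_add_norm_sub (v k t) (W ((t : ℝ) / 2 ^ k)) (W x₀)
        linarith [hK k hk t]
      have heq : u k t - ((t : ℝ) / 2 ^ k) • W x₀ -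
          (u k (t - 1) - (((t - 1 : ℤ) : ℝ) / 2 ^ k) • W x₀) =
          ((2 : ℝ) ^ k)⁻¹ • (v k t - W x₀) := by
        rw [huv, smul_sub, smul_smul, inv_mul_cancel₀ h2.ne', one_smul]
        push_cast
        rw [sub_div, sub_smul, one_div]
        abel
      rw [heq, norm_smul, norm_inv, norm_pow, Real.norm_two, div_eq_inv_mul]
      gcongr
  rw [hasDerivAt_iff_isLittleO, Asymptotics.isLittleO_iff]
  intro ε hε
  obtain ⟨δ, hδ, h⟩ := key ε hε
  filter_upwards [Metric.ball_mem_nhds x₀ hδ] with x hx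
  rw [Metric.mem_ball, Real.dist_eq] at hx
  rcases le_total x₀ x with hle | hle
  · rw [Real.norm_of_nonneg (sub_nonneg.2 hle)]
    exact h x x₀ hle hx (by simpa using hδ)
  · have := h x₀ x hle (by simpa using hδ) hx
    have heq : U x - U x₀ - (x - x₀) • W x₀ = -(U x₀ - U x - (x₀ - x) • W x₀) := by
      rw [← neg_sub x₀ x, neg_smul]
      abel
    rwa [Real.norm_of_nonpos (sub_nonpos.2 hle), neg_sub, heq, norm_neg]

theorem contDiff_of_uconv [NormedSpace ℝ V] {q : ℕ → ℕ → ℤ → V} {F : ℕ → ℝ → V} {m : ℕ}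
    (hF : ∀ s ≤ m, Continuous (F s)) (hq : ∀ s ≤ m, UConv (q s) (F s))
    (hstep : ∀ s k i, q (s + 1) k i = (2 : ℝ) ^ k • (q s k i - q s k (i - 1))) :
    ContDiff ℝ m (F 0) := by
  have h : ∀ r s, s + r ≤ m → ContDiff ℝ r (F s) := by
    intro r
    induction r with
    | zero => exact fun s hs => contDiff_zero.2 (hF s hs)
    | succ r ih =>
      intro s hs
      have hd := (hq s (by omega)).hasDerivAt (hF s (by omega)) (hq (s + 1) (by omega))
        (hF (s + 1) (by omega)) (hstep s)
      push_cast
      refine contDiff_succ_iff_deriv.2 ⟨fun x => (hd x).differentiableAt, by simp, ?_⟩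
      rw [funext fun x => (hd x).deriv]
      exact ih (s + 1) (by omega)
  exact h m 0 (by omega)

end UniformConvergence

section Limits

variable {V : Type*} [NormedAddCommGroup V] [NormedSpace ℝ V] {β : ℤ → ℝ} {N : ℕ} {φ : ℝ → ℝ}

theorem limit_eq_zero (hβ : SuppIn β N) (hφ : Continuous φ) (h : UConv (kernel β) φ) {x : ℝ}
    (hx : (N : ℝ) + 1 ≤ |x|) : φ x = 0 := by
  refine tendsto_nhds_unique (h.tendsto hφ x) (tendsto_const_nhds.congr fun k => ?_)
  refine (hβ.kernel_eq_zero' k _ ?_).symm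
  have h2 : (0 : ℝ) < 2 ^ k := by positivity
  have h3 : (0 : ℤ) < 2 ^ k := by positivity
  rw [lt_abs]
  rcases le_abs.1 hx with hx | hx
  · left
    have : (2 ^ k * ((N : ℤ) + 1)) ≤ ⌊x * 2 ^ k⌋ := by
      rw [Int.le_floor]
      push_cast
      nlinarith
    linarith
  · right
    have : ⌊x * 2 ^ k⌋ ≤ -(2 ^ k * ((N : ℤ) + 1)) := by
      have h4 : (⌊x * 2 ^ k⌋ : ℝ) ≤ -(2 ^ k * ((N : ℝ) + 1)) := by
        refine (Int.floor_le _).trans ?_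
        nlinarith
      exact_mod_cast h4
    linarith

theorem limit_hasCompactSupport (hβ : SuppIn β N) (hφ : Continuous φ)
    (h : UConv (kernel β) φ) : HasCompactSupport φ :=
  HasCompactSupport.intro (isCompact_Icc (a := -((N : ℝ) + 1)) (b := N + 1)) fun x hx =>
    limit_eq_zero hβ hφ h (le_of_lt (by
      rw [Set.mem_Icc, ← abs_le] at hx
      exact not_le.1 hx))

theorem exists_kernel_bound (hβ : SuppIn β N) (hφ : Continuous φ) (h : UConv (kernel β) φ) :
    ∃ C : ℝ, 0 ≤ C ∧ ∀ k i, |kernel β k i| ≤ C := by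
  obtain ⟨C, hC⟩ := hφ.bounded_above_of_compact_support (limit_hasCompactSupport hβ hφ h)
  obtain ⟨K, hK⟩ := h 1 one_pos
  have hsmall : ∀ k, ∃ B : ℝ, 0 ≤ B ∧ ∀ i, |kernel β k i| ≤ B := by
    obtain ⟨B, hB0, hB⟩ := hβ.exists_bound
    intro k
    induction k with
    | zero => exact ⟨1, zero_le_one, fun i => by simp only [kernel]; split_ifs <;> simp⟩
    | succ k ih =>
      obtain ⟨B', hB0', hB'⟩ := ih
      exact ⟨(2 * N + 1) * B * B', by positivity,
        fun i => hβ.norm_subdiv_le (f := kernel β k) hB hB' i⟩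
  choose B hB0 hB using hsmall
  have hC0 : 0 ≤ C := (norm_nonneg _).trans (hC 0)
  have hsum : 0 ≤ ∑ k ∈ Finset.range K, B k := Finset.sum_nonneg fun k _ => hB0 k
  refine ⟨C + 1 + ∑ k ∈ Finset.range K, B k, by positivity, fun k i => ?_⟩
  rcases lt_or_ge k K with hk | hk
  · have := Finset.single_le_sum (f := B) (fun k _ => hB0 k) (Finset.mem_range.2 hk)
    linarith [hB k i]
  · have h1 := hK k hk i
    have h2 := hC ((i : ℝ) / 2 ^ k)
    rw [Real.norm_eq_abs] at h1 h2
    have := abs_sub_abs_le_abs_sub (kernel β k i) (φ ((i : ℝ) / 2 ^ k))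
    linarith

theorem norm_iterate_subdiv_le (hβ : SuppIn β N) {C B : ℝ} (hC : ∀ k i, |kernel β k i| ≤ C)
    {f : ℤ → V} (hf : ∀ i, ‖f i‖ ≤ B) (k : ℕ) (i : ℤ) :
    ‖(subdiv β)^[k] f i‖ ≤ (2 * N + 1) * C * B := by
  rw [hβ.iterate_subdiv_apply]
  exact norm_finsum_dilate_le (by positivity) (hβ.kernel_eq_zero' k) (hC k) hf i

/-- If the basic limit function exists, the scheme converges for all bounded data. -/
theorem exists_limit_of_kernel (hβ : SuppIn β N) (hφ : Continuous φ) (h : UConv (kernel β) φ)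
    {f : ℤ → V} {B : ℝ} (hf : ∀ i, ‖f i‖ ≤ B) :
    ∃ F : ℝ → V, Continuous F ∧ UConv (fun k => (subdiv β)^[k] f) F := by
  refine ⟨fun x => ∑ᶠ l : ℤ, φ (x - l) • f l, continuous_finsum (fun l => by fun_prop) ?_, ?_⟩
  · intro x
    refine ⟨Metric.ball x 1, Metric.ball_mem_nhds x one_pos,
      (Set.finite_Icc ⌊x - (N + 2)⌋ ⌈x + (N + 2)⌉).subset ?_⟩
    rintro l ⟨y, hy, hyx⟩
    have h1 : |y - l| < N + 1 := by
      by_contra! hge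
      exact hy (by simp [limit_eq_zero hβ hφ h hge])
    rw [Metric.mem_ball, Real.dist_eq] at hyx
    rw [abs_lt] at h1 hyx
    constructor
    · have : (⌊x - (N + 2)⌋ : ℝ) ≤ l := (Int.floor_le _).trans (by linarith)
      exact_mod_cast this
    · have : (l : ℝ) ≤ ⌈x + (N + 2)⌉ := le_trans (by linarith) (Int.le_ceil _)
      exact_mod_cast this
  · intro ε hε
    have hB0 : 0 ≤ B := (norm_nonneg _).trans (hf 0)
    obtain ⟨K, hK⟩ := h (ε / ((2 * (N + 1 : ℕ) + 1) * (B + 1))) (by positivity)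
    refine ⟨K, fun k hk i => ?_⟩
    have h2 : (0 : ℤ) < 2 ^ k := by positivity
    have h2' : (0 : ℝ) < 2 ^ k := by positivity
    have s1 : ∀ t, 2 ^ k * ((N + 1 : ℕ) : ℤ) < |t| → kernel β k t = 0 := fun t ht =>
      hβ.kernel_eq_zero' k t (by push_cast at ht; linarith)
    have s2 : ∀ t : ℤ, 2 ^ k * ((N + 1 : ℕ) : ℤ) < |t| → φ ((t : ℝ) / 2 ^ k) = 0 := by
      intro t ht
      refine limit_eq_zero hβ hφ h ?_
      rw [abs_div, abs_of_pos h2', le_div_iff₀ h2', mul_comm]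
      exact_mod_cast ht.le
    have s3 : ∀ t : ℤ, 2 ^ k * ((N + 1 : ℕ) : ℤ) < |t| →
        kernel β k t - φ ((t : ℝ) / 2 ^ k) = 0 := fun t ht => by rw [s1 t ht, s2 t ht, sub_zero]
    have hF : ∑ᶠ l : ℤ, φ ((i : ℝ) / 2 ^ k - l) • f l =
        ∑ᶠ l : ℤ, φ (((i - 2 ^ k * l : ℤ) : ℝ) / 2 ^ k) • f l := by
      refine finsum_congr fun l => ?_
      congr 2
      push_cast
      field_simp
    simp only []
    rw [hβ.iterate_subdiv_apply, hF,
      ← finsum_sub_distrib (finite_support_dilate h2 s1 f i)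
        (finite_support_dilate (κ := fun t : ℤ => φ ((t : ℝ) / 2 ^ k)) h2 s2 f i)]
    simp only [← sub_smul]
    refine (norm_finsum_dilate_le (κ := fun t : ℤ => kernel β k t - φ ((t : ℝ) / 2 ^ k)) h2 s3
      (fun t => hK k hk t) hf i).trans ?_
    rw [mul_div_assoc', div_mul_eq_mul_div, div_le_iff₀ (by positivity)]
    have : (0 : ℝ) < (2 * (N + 1 : ℕ) + 1) * ε := by positivity
    nlinarith

theorem two_pow_mul_kernel_avgMask_sub (hβ : SuppIn β N) (k : ℕ) (i : ℤ) :
    (2 : ℝ) ^ k * (kernel (avgMask β) k i - kernel (avgMask β) k (i - 1)) =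
      kernel β k i - kernel β k (i - 2 ^ k) := by
  induction k generalizing i with
  | zero => simp [kernel]
  | succ k ih =>
    have h1 := congrFun (hβ.bdiff_subdiv_avgMask (kernel (avgMask β) k)) i
    have h2 : (2 : ℝ) ^ k • bdiff (kernel (avgMask β) k) =
        kernel β k - fun j => kernel β k (j - 2 ^ k) := by
      funext j
      exact ih j
    have h3 := congrFun (subdiv_smul β ((2 : ℝ) ^ k) (bdiff (kernel (avgMask β) k))) i
    rw [h2, hβ.subdiv_sub, Pi.sub_apply, subdiv_shift, ← pow_succ'] at h3
    change kernel (avgMask β) (k + 1) i - kernel (avgMask β) (k + 1) (i - 1) = _ at h1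
    rw [h1, pow_succ]
    simp only [Pi.smul_apply, smul_eq_mul] at h3 ⊢
    rw [kernel, h3]
    ring

/-- Averaging the mask preserves the existence of a basic limit function: the new one is
`∫ (φ(t) - φ(t - 1)) dt`. -/
theorem exists_limit_avgMask (hβ : SuppIn β N) (hφ : Continuous φ) (h : UConv (kernel β) φ) :
    ∃ ψ : ℝ → ℝ, Continuous ψ ∧ UConv (kernel (avgMask β)) ψ := by
  have hφu := (limit_hasCompactSupport hβ hφ h).uniformContinuous_of_continuous hφ
  set W : ℝ → ℝ := fun x => φ x - φ (x - 1) with hWdef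
  have hWu : UniformContinuous W := by
    refine hφu.sub (hφu.comp ?_)
    exact uniformContinuous_id.sub uniformContinuous_const
  have hW : Continuous W := hWu.continuous
  have hint : ∀ a b, IntervalIntegrable W MeasureTheory.volume a b :=
    fun a b => hW.intervalIntegrable a b
  set M : ℝ := N + 2 with hM
  have hM0 : 0 < M := by positivity
  have hW0 : ∀ x, M ≤ |x| → W x = 0 := by
    intro x hx
    rw [hWdef]
    simp only []
    rw [limit_eq_zero hβ hφ h (x := x) (by linarith), limit_eq_zero hβ hφ h (x := x - 1), sub_zero]
    have := abs_sub_abs_le_abs_sub x 1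
    rw [abs_one] at this
    linarith
  set ψ : ℝ → ℝ := fun x => ∫ t in (-M)..x, W t with hψ
  have hψsub : ∀ x y, ψ x - ψ y = ∫ t in y..x, W t := fun x y =>
    intervalIntegral.integral_interval_sub_left (hint _ _) (hint _ _)
  have hψconst : ∀ x y, (∀ t ∈ Set.uIcc y x, M ≤ |t|) → ψ x = ψ y := by
    intro x y hxy
    rw [← sub_eq_zero, hψsub, intervalIntegral.integral_congr fun t ht => hW0 t (hxy t ht)]
    simp
  refine ⟨ψ, continuous_iff_continuousAt.2 fun x =>
    (hW.integral_hasStrictDerivAt (-M) x).hasDerivAt.continuousAt, fun ε hε => ?_⟩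
  set η : ℝ := ε / (6 * M) with hη
  have hη0 : 0 < η := by positivity
  obtain ⟨δ, hδ, hδW⟩ := Metric.uniformContinuous_iff.1 hWu η hη0
  obtain ⟨K₁, hK₁⟩ := h η hη0
  obtain ⟨K₂, hK₂⟩ := exists_pow_lt_of_lt_one hδ (show (2 : ℝ)⁻¹ < 1 by norm_num)
  refine ⟨max K₁ K₂, fun k hk i => ?_⟩
  have h2 : (0 : ℝ) < 2 ^ k := by positivity
  have h2' : (0 : ℤ) < 2 ^ k := by positivity
  have hkδ : ((2 : ℝ) ^ k)⁻¹ < δ := by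
    rw [← inv_pow]
    exact (pow_le_pow_of_le_one (by norm_num) (by norm_num)
      ((le_max_right _ _).trans hk)).trans_lt hK₂
  set g : ℤ → ℝ := fun i => kernel (avgMask β) k i - ψ ((i : ℝ) / 2 ^ k) with hg
  have hstep : ∀ t, ‖g t - g (t - 1)‖ ≤ 3 * η / 2 ^ k := by
    intro t
    have e1 := two_pow_mul_kernel_avgMask_sub hβ k t
    have e2 : |ψ ((t : ℝ) / 2 ^ k) - ψ (((t - 1 : ℤ) : ℝ) / 2 ^ k) - W ((t : ℝ) / 2 ^ k) / 2 ^ k|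
        ≤ η / 2 ^ k := by
      have hlen : (t : ℝ) / 2 ^ k - ((t - 1 : ℤ) : ℝ) / 2 ^ k = (2 ^ k)⁻¹ := by
        push_cast
        field_simp
        ring
      have e3 : (∫ _ in (((t - 1 : ℤ) : ℝ) / 2 ^ k)..((t : ℝ) / 2 ^ k), W ((t : ℝ) / 2 ^ k)) =
          W ((t : ℝ) / 2 ^ k) / 2 ^ k := by
        rw [intervalIntegral.integral_const, hlen, smul_eq_mul, inv_mul_eq_div]
      rw [hψsub, ← e3, ← intervalIntegral.integral_sub (hint _ _) intervalIntegrable_const,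
        ← Real.norm_eq_abs]
      refine (intervalIntegral.norm_integral_le_of_norm_le_const (C := η) fun s hs => ?_).trans ?_
      · rw [← dist_eq_norm]
        refine (hδW ?_).le
        rw [Set.uIoc_of_le (by rw [← sub_nonneg, hlen]; positivity)] at hs
        rw [Real.dist_eq, abs_lt]
        constructor <;> linarith [hs.1, hs.2, inv_pos.2 h2]
      · rw [hlen, abs_of_pos (inv_pos.2 h2), div_eq_mul_inv]
    have e4 := hK₁ k ((le_max_left _ _).trans hk) t
    have e5 := hK₁ k ((le_max_left _ _).trans hk) (t - 2 ^ k)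
    have e6 : ((t - 2 ^ k : ℤ) : ℝ) / 2 ^ k = (t : ℝ) / 2 ^ k - 1 := by
      push_cast
      field_simp
    rw [e6] at e5
    rw [hWdef] at e2
    simp only [Real.norm_eq_abs] at *
    have e7 : g t - g (t - 1) =
        (kernel β k t - φ ((t : ℝ) / 2 ^ k)) / 2 ^ k -
        (kernel β k (t - 2 ^ k) - φ ((t : ℝ) / 2 ^ k - 1)) / 2 ^ k -
        (ψ ((t : ℝ) / 2 ^ k) - ψ (((t - 1 : ℤ) : ℝ) / 2 ^ k) -
          (φ ((t : ℝ) / 2 ^ k) - φ ((t : ℝ) / 2 ^ k - 1)) / 2 ^ k) := by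
      have : kernel (avgMask β) k t - kernel (avgMask β) k (t - 1) =
          (kernel β k t - kernel β k (t - 2 ^ k)) / 2 ^ k := by
        rw [← e1]
        field_simp
      simp only [hg]
      linear_combination this
    rw [e7]
    refine (abs_sub _ _).trans ?_
    refine (add_le_add_left (abs_sub _ _) _).trans ?_
    rw [abs_div, abs_div, abs_of_pos h2]
    have e8 := div_le_div_of_nonneg_right e4 h2.le
    have e9 := div_le_div_of_nonneg_right e5 h2.le
    have : 3 * η / 2 ^ k = η / 2 ^ k + η / 2 ^ k + η / 2 ^ k := by ring
    rw [this]
    exact add_le_add (add_le_add e8 e9) e2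
  set i₁ : ℤ := 2 ^ k * (N + 2) with hi₁
  have hi₁' : (i₁ : ℝ) / 2 ^ k = M := by
    rw [hi₁]
    push_cast
    field_simp
    rw [hM]
  have hi₀' : ((-i₁ : ℤ) : ℝ) / 2 ^ k = -M := by
    push_cast
    rw [neg_div, hi₁']
  have hker : ∀ t, i₁ ≤ |t| → kernel (avgMask β) k t = 0 := by
    intro t ht
    refine hβ.avg.kernel_eq_zero' k t ?_
    push_cast
    linarith
  have hψM : ψ (-M) = 0 := by simp [hψ]
  have hg₀ : g (-i₁) = 0 := by
    simp only [hg]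
    rw [hi₀', hψM, hker _ (by rw [abs_neg]; exact le_abs_self _), sub_zero]
  have hmid : ∀ t, -i₁ ≤ t → t ≤ i₁ → ‖g t‖ ≤ ε := by
    intro t h1 h3
    have h4 := norm_sub_le_of_step h1 fun s _ _ => hstep s
    rw [hg₀, sub_zero] at h4
    refine h4.trans ?_
    have h5 : (t : ℝ) - ((-i₁ : ℤ) : ℝ) ≤ 2 * (2 ^ k * M) := by
      have h6 : (t : ℝ) ≤ i₁ := by exact_mod_cast h3
      have h7 : (i₁ : ℝ) = 2 ^ k * M := by rw [← hi₁']; field_simp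
      push_cast
      linarith
    refine (mul_le_mul_of_nonneg_left h5 (by positivity)).trans (le_of_eq ?_)
    rw [hη]
    field_simp
    norm_num
  change ‖g i‖ ≤ ε
  rcases le_total i (-i₁) with h1 | h1
  · have : g i = 0 := by
      have h3 : (i : ℝ) / 2 ^ k ≤ -M := by
        rw [← hi₀']
        gcongr
      simp only [hg]
      rw [hker i (by rw [le_abs]; right; linarith), hψconst _ (-M), hψM, sub_zero]
      intro t ht
      rw [Set.uIcc_of_ge h3] at ht
      rw [le_abs]
      right
      linarith [ht.2]
    rw [this, norm_zero]
    exact hε.le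
  · rcases le_total i i₁ with h3 | h3
    · exact hmid i h1 h3
    · have : g i = g i₁ := by
        have h4 : M ≤ (i : ℝ) / 2 ^ k := by
          rw [← hi₁']
          gcongr
        simp only [hg]
        rw [hker i (h3.trans (le_abs_self _)), hker i₁ (le_abs_self _), hi₁', hψconst _ M]
        intro t ht
        rw [Set.uIcc_of_le h4] at ht
        exact ht.1.trans (le_abs_self _)
      rw [this]
      exact hmid i₁ (by linarith [show 0 ≤ i₁ by positivity]) le_rfl

end Limits

section Perturbation

variable {V : Type*} [NormedAddCommGroup V] [NormedSpace ℝ V] {β : ℤ → ℝ} {N : ℕ} {φ : ℝ → ℝ}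

/-- The iterates of the scheme with mask `β` are bounded by `L` on bounded `V`-valued data. -/
def StableMask (V : Type*) [NormedAddCommGroup V] [NormedSpace ℝ V] (β : ℤ → ℝ) (L : ℝ) : Prop :=
  ∀ (f : ℤ → V) (B : ℝ), (∀ i, ‖f i‖ ≤ B) → ∀ k i, ‖(subdiv β)^[k] f i‖ ≤ L * B

theorem exists_stableMask (V : Type*) [NormedAddCommGroup V] [NormedSpace ℝ V]
    (hβ : SuppIn β N) (hφ : Continuous φ) (h : UConv (kernel β) φ) :
    ∃ L : ℝ, 0 ≤ L ∧ StableMask V β L := by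
  obtain ⟨C, hC0, hC⟩ := exists_kernel_bound hβ hφ h
  exact ⟨(2 * N + 1) * C, by positivity, fun f B hf => norm_iterate_subdiv_le hβ hC hf⟩

theorem StableMask.mono {L L' : ℝ} (h : StableMask V β L) (hL : L ≤ L') : StableMask V β L' :=
  fun f B hf k i => (h f B hf k i).trans
    (mul_le_mul_of_nonneg_right hL ((norm_nonneg _).trans (hf 0)))

theorem norm_sub_iterate_le (hβ : SuppIn β N) {L : ℝ} (hL : StableMask V β L)
    {q e : ℕ → ℤ → V} (hq : ∀ k, q (k + 1) = subdiv β (q k) + e k) {ε : ℕ → ℝ} (k K : ℕ)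
    (he : ∀ l < k, ∀ i, ‖e (K + l) i‖ ≤ ε (K + l)) (i : ℤ) :
    ‖q (K + k) i - (subdiv β)^[k] (q K) i‖ ≤ L * ∑ l ∈ Finset.range k, ε (K + l) := by
  induction k generalizing K with
  | zero => simp
  | succ k ih =>
    have h1 := ih (K + 1) fun l hl i => by
      have := he (l + 1) (by omega) i
      rwa [← add_assoc, add_right_comm] at this
    have h2 : (subdiv β)^[k] (q (K + 1)) - (subdiv β)^[k + 1] (q K) = (subdiv β)^[k] (e K) := by
      rw [Function.iterate_succ_apply, ← hβ.iterate_subdiv_sub, hq, add_sub_cancel_left]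
    have h3 := hL (e K) (ε K) (fun i => he 0 (by omega) i) k i
    rw [← h2, Pi.sub_apply] at h3
    have h4 := norm_sub_le_norm_sub_add_norm_sub (q (K + 1 + k) i) ((subdiv β)^[k] (q (K + 1)) i)
      ((subdiv β)^[k + 1] (q K) i)
    rw [show K + (k + 1) = K + 1 + k by ring, Finset.sum_range_succ']
    have hs : ∑ l ∈ Finset.range k, ε (K + (l + 1)) = ∑ l ∈ Finset.range k, ε (K + 1 + l) :=
      Finset.sum_congr rfl fun l _ => by rw [show K + (l + 1) = K + 1 + l by ring]
    rw [hs, add_zero]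
    linarith

theorem exists_limit_of_perturbation [CompleteSpace V] (hβ : SuppIn β N) (hφ : Continuous φ)
    (h : UConv (kernel β) φ) {q e : ℕ → ℤ → V} (hq : ∀ k, q (k + 1) = subdiv β (q k) + e k)
    {B C γ : ℝ} (hγ0 : 0 < γ) (hγ1 : γ < 1) (he : ∀ k i, ‖e k i‖ ≤ B * γ ^ k)
    (hqC : ∀ k i, ‖q k i‖ ≤ C) :
    ∃ F : ℝ → V, Continuous F ∧ UConv q F := by
  obtain ⟨L, hL0, hL⟩ := exists_stableMask V hβ hφ h
  have hB0 : 0 ≤ B := by simpa using (norm_nonneg _).trans (he 0 0)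
  have hγ : 0 < 1 - γ := sub_pos.2 hγ1
  refine exists_uconv_of_approx fun ε hε => ?_
  obtain ⟨K, hK⟩ := exists_pow_lt_of_lt_one
    (show 0 < ε / 2 / (L * B / (1 - γ) + 1) by positivity) hγ1
  obtain ⟨G, hG, hGu⟩ := exists_limit_of_kernel hβ hφ h (hqC K)
  obtain ⟨K', hK'⟩ := hGu (ε / 2) (by positivity)
  refine ⟨fun x => G (x * 2 ^ K), by fun_prop, K + K', fun k hk i => ?_⟩
  obtain ⟨k, rfl⟩ := Nat.exists_eq_add_of_le (show K ≤ k by omega)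
  have h1 := norm_sub_iterate_le hβ hL hq (ε := fun k => B * γ ^ k) k K (fun l _ i => he _ i) i
  have h2 := hK' k (by omega) i
  have h3 : L * ∑ l ∈ Finset.range k, B * γ ^ (K + l) ≤ ε / 2 := by
    have hgeom : ∑ l ∈ Finset.range k, γ ^ l ≤ (1 - γ)⁻¹ := by
      rw [← tsum_geometric_of_lt_one hγ0.le hγ1]
      exact (summable_geometric_of_lt_one hγ0.le hγ1).sum_le_tsum _ fun l _ => by positivity
    rw [lt_div_iff₀ (by positivity)] at hK
    simp only [pow_add, ← Finset.mul_sum]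
    calc L * (B * (γ ^ K * ∑ l ∈ Finset.range k, γ ^ l))
        ≤ L * (B * (γ ^ K * (1 - γ)⁻¹)) := by gcongr
      _ = γ ^ K * (L * B / (1 - γ)) := by ring
      _ ≤ ε / 2 := by nlinarith [pow_pos hγ0 K]
  have h4 := norm_sub_le_norm_sub_add_norm_sub (q (K + k) i) ((subdiv β)^[k] (q K) i)
    (G ((i : ℝ) / 2 ^ k))
  have h5 : (i : ℝ) / 2 ^ (K + k) * 2 ^ K = (i : ℝ) / 2 ^ k := by
    rw [pow_add]
    field_simp
  dsimp only at h2 ⊢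
  rw [h5]
  linarith

/-- A discrete Grönwall estimate for a finite family of perturbed subdivision schemes. -/
theorem exists_bound_of_perturbation {b : ℕ → ℤ → ℝ} {Ns : ℕ → ℕ} {n : ℕ}
    (hb : ∀ s, SuppIn (b s) (Ns s)) {L : ℝ} (hL0 : 0 ≤ L)
    (hL : ∀ s ≤ n, StableMask V (b s) L) {q e : ℕ → ℕ → ℤ → V}
    (hq : ∀ s ≤ n, ∀ k, q s (k + 1) = subdiv (b s) (q s k) + e s k)
    {B C γ : ℝ} (hB0 : 0 ≤ B) (hγ0 : 0 < γ) (hγ1 : γ < 1)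
    (he : ∀ k Y, (∀ s ≤ n, ∀ i, ‖q s k i‖ ≤ Y) → ∀ s ≤ n, ∀ i, ‖e s k i‖ ≤ B * γ ^ k * Y)
    (hq0 : ∀ s ≤ n, ∀ i, ‖q s 0 i‖ ≤ C) :
    ∃ Y, ∀ k, ∀ s ≤ n, ∀ i, ‖q s k i‖ ≤ Y := by
  have hC0 : 0 ≤ C := (norm_nonneg _).trans (hq0 0 (Nat.zero_le _) 0)
  set Y : ℕ → ℝ := fun k => L * C * ∏ l ∈ Finset.range k, (1 + L * B * γ ^ l) with hY
  have hYsum : ∀ k, L * C + L * ∑ l ∈ Finset.range k, B * γ ^ l * Y l = Y k := by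
    intro k
    induction k with
    | zero => simp [hY]
    | succ k ih =>
      rw [Finset.sum_range_succ, mul_add, ← add_assoc, ih]
      simp only [hY, Finset.prod_range_succ]
      ring
  have hbound : ∀ k, ∀ s ≤ n, ∀ i, ‖q s k i‖ ≤ Y k := by
    intro k
    induction k using Nat.strong_induction_on with
    | _ k ih =>
      intro s hs i
      have h1 := norm_sub_iterate_le (hb s) (hL s hs) (hq s hs) (ε := fun l => B * γ ^ l * Y l)
        k 0 (fun l hl i => by rw [zero_add]; exact he l (Y l) (ih l hl) s hs i) i
      have h2 := hL s hs _ C (hq0 s hs) k i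
      simp only [zero_add] at h1
      rw [← hYsum]
      have h3 := norm_sub_norm_le (q s k i) ((subdiv (b s))^[k] (q s 0) i)
      linarith
  refine ⟨L * C * Real.exp (L * B * (1 - γ)⁻¹), fun k s hs i => (hbound k s hs i).trans ?_⟩
  refine mul_le_mul_of_nonneg_left ?_ (by positivity)
  calc ∏ l ∈ Finset.range k, (1 + L * B * γ ^ l)
      ≤ ∏ l ∈ Finset.range k, Real.exp (L * B * γ ^ l) :=
        Finset.prod_le_prod (fun l _ => by positivity) fun l _ => by
          rw [add_comm]; exact Real.add_one_le_exp _
    _ = Real.exp (L * B * ∑ l ∈ Finset.range k, γ ^ l) := by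
        rw [Finset.mul_sum, Real.exp_sum]
    _ ≤ Real.exp (L * B * (1 - γ)⁻¹) := by
        have hgeom : ∑ l ∈ Finset.range k, γ ^ l ≤ (1 - γ)⁻¹ := by
          rw [← tsum_geometric_of_lt_one hγ0.le hγ1]
          exact (summable_geometric_of_lt_one hγ0.le hγ1).sum_le_tsum _ fun l _ => by positivity
        gcongr

theorem exists_limit_iterate_avgMask (hβ : SuppIn β N) (hφ : Continuous φ)
    (h : UConv (kernel β) φ) (r : ℕ) :
    ∃ ψ : ℝ → ℝ, Continuous ψ ∧ UConv (kernel (avgMask^[r] β)) ψ := by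
  induction r with
  | zero => exact ⟨φ, hφ, h⟩
  | succ r ih =>
    obtain ⟨ψ, hψ, hr⟩ := ih
    rw [Function.iterate_succ_apply']
    exact exists_limit_avgMask (hβ.iterate_avgMask r) hψ hr

/-- If the perturbation `e k` of a scheme with mask symbol `((1 + z) / 2) ^ m b(z)` is
geometrically small together with its scaled differences up to order `n ≤ m`, relative to those
of `p k`, then the perturbed scheme has limits of class `C ^ n`. -/
theorem exists_contDiff_limit_of_perturbation [CompleteSpace V] (hβ : SuppIn β N)
    (hφ : Continuous φ) (h : UConv (kernel β) φ) {m n : ℕ} (hnm : n ≤ m) {p e : ℕ → ℤ → V}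
    (hp : ∀ k, p (k + 1) = subdiv (avgMask^[m] β) (p k) + e k)
    {B C γ : ℝ} (hB0 : 0 ≤ B) (hγ0 : 0 < γ) (hγ1 : γ < 1) (hp0 : ∀ i, ‖p 0 i‖ ≤ C)
    (he : ∀ k Y, (∀ s ≤ n, ∀ i, ‖bdiff^[s] (p k) i‖ ≤ Y * ((2 : ℝ)⁻¹ ^ k) ^ s) →
      ∀ s ≤ n, ∀ i, ‖bdiff^[s] (e k) i‖ ≤ B * γ ^ k * Y * ((2 : ℝ)⁻¹ ^ k) ^ s) :
    ∃ P : ℝ → V, ContDiff ℝ n P ∧ UConv p P := by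
  choose ψ hψ hψu using exists_limit_iterate_avgMask hβ hφ h
  choose Ls hLs0 hLs using fun r => exists_stableMask V (hβ.iterate_avgMask r) (hψ r) (hψu r)
  set L : ℝ := ∑ r ∈ Finset.range (m + 1), Ls r with hLdef
  have hL0 : 0 ≤ L := Finset.sum_nonneg fun r _ => hLs0 r
  have hL : ∀ s ≤ n, StableMask V (avgMask^[m - s] β) L := fun s _ =>
    (hLs (m - s)).mono (Finset.single_le_sum (f := Ls) (fun r _ => hLs0 r)
      (Finset.mem_range.2 (by omega)))
  set q : ℕ → ℕ → ℤ → V := fun s k => ((2 : ℝ) ^ k) ^ s • bdiff^[s] (p k) with hqdef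
  set E : ℕ → ℕ → ℤ → V := fun s k => ((2 : ℝ) ^ (k + 1)) ^ s • bdiff^[s] (e k) with hEdef
  have hq : ∀ s ≤ n, ∀ k, q s (k + 1) = subdiv (avgMask^[m - s] β) (q s k) + E s k := by
    intro s hs k
    have h1 := hβ.iterate_bdiff_subdiv (m - s) s (p k)
    rw [show m - s + s = m by omega] at h1
    simp only [hqdef, hEdef]
    rw [hp, iterate_bdiff_add, h1, smul_add, smul_smul, subdiv_smul, ← mul_pow, pow_succ]
    congr 3
    rw [mul_assoc, mul_inv_cancel₀ two_ne_zero, mul_one]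
  have hEb : ∀ k Y, (∀ s ≤ n, ∀ i, ‖q s k i‖ ≤ Y) → ∀ s ≤ n, ∀ i,
      ‖E s k i‖ ≤ 2 ^ n * B * γ ^ k * Y := by
    intro k Y hY s hs i
    have hY0 : 0 ≤ Y := (norm_nonneg _).trans (hY 0 (Nat.zero_le _) 0)
    have h1 := he k Y (fun s hs i => ?_) s hs i
    · simp only [hEdef, Pi.smul_apply]
      rw [norm_smul, norm_pow, norm_pow, Real.norm_two, pow_succ, mul_pow]
      calc (2 ^ k) ^ s * 2 ^ s * ‖bdiff^[s] (e k) i‖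
          ≤ (2 ^ k) ^ s * 2 ^ s * (B * γ ^ k * Y * ((2 : ℝ)⁻¹ ^ k) ^ s) := by gcongr
        _ = 2 ^ s * B * γ ^ k * Y * ((2 ^ k) ^ s * ((2 : ℝ)⁻¹ ^ k) ^ s) := by ring
        _ = 2 ^ s * B * γ ^ k * Y := by
          rw [← mul_pow, ← mul_pow, mul_inv_cancel₀ two_ne_zero, one_pow, one_pow, mul_one]
        _ ≤ 2 ^ n * B * γ ^ k * Y := by
          gcongr
          exact one_le_two
    · have h2 := hY s hs i
      simp only [hqdef, Pi.smul_apply] at h2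
      rw [norm_smul, norm_pow, norm_pow, Real.norm_two] at h2
      rwa [inv_pow, inv_pow, ← div_eq_mul_inv, le_div_iff₀ (by positivity), mul_comm]
  have hq0 : ∀ s ≤ n, ∀ i, ‖q s 0 i‖ ≤ 2 ^ n * C := by
    intro s hs i
    have hC0 : 0 ≤ C := (norm_nonneg _).trans (hp0 0)
    simp only [hqdef, pow_zero, one_pow, one_smul]
    refine (norm_iterate_bdiff_le s hp0 i).trans ?_
    gcongr
    exact one_le_two
  obtain ⟨Y, hY⟩ := exists_bound_of_perturbation (fun s => hβ.iterate_avgMask (m - s)) hL0 hL hq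
    (by positivity) hγ0 hγ1 hEb hq0
  have hlim : ∀ s, ∃ F : ℝ → V, s ≤ n → Continuous F ∧ UConv (q s) F := by
    intro s
    by_cases hs : s ≤ n
    · obtain ⟨F, hF, hFu⟩ := exists_limit_of_perturbation (hβ.iterate_avgMask (m - s))
        (hψ (m - s)) (hψu (m - s)) (hq s hs) (B := 2 ^ n * B * Y) hγ0 hγ1
        (fun k i => (hEb k Y (hY k) s hs i).trans (le_of_eq (by ring)))
        (fun k i => hY k s hs i)
      exact ⟨F, fun _ => ⟨hF, hFu⟩⟩
    · exact ⟨0, fun h => absurd h hs⟩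
  choose F hF using hlim
  refine ⟨F 0, contDiff_of_uconv (fun s hs => (hF s hs).1) (fun s hs => (hF s hs).2) ?_, ?_⟩
  · intro s k i
    simp only [hqdef, Pi.smul_apply, Function.iterate_succ_apply']
    rw [bdiff, ← smul_sub, smul_smul, pow_succ']
  · have h0 : q 0 = p := by
      funext k i
      simp [hqdef]
    rw [← h0]
    exact (hF 0 (Nat.zero_le _)).2

end Perturbation

section DiffBound

variable {ι ι' : Type*} [AddCommGroup ι] [AddCommGroup ι'] {E : Set ι} {E' : Set ι'}
variable {V : Type*} [NormedAddCommGroup V]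

/-- All iterated backward differences of `X` of order `s ≤ n` in the directions of `E` are bounded
by `K * h ^ s`. -/
def DiffBound (E : Set ι) (h : ℝ) : ℕ → ℝ → (ι → V) → Prop
  | 0, K, X => ∀ x, ‖X x‖ ≤ K
  | n + 1, K, X => (∀ x, ‖X x‖ ≤ K) ∧
      ∀ e ∈ E, DiffBound E h n (K * h) (fun x => X x - X (x - e))

variable {h : ℝ} {n : ℕ} {K K' : ℝ} {X X' : ι → V}

theorem DiffBound.norm_le (hX : DiffBound E h n K X) (x : ι) : ‖X x‖ ≤ K := by
  cases n with
  | zero => exact hX x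
  | succ n => exact hX.1 x

theorem DiffBound.nonneg (hX : DiffBound E h n K X) : 0 ≤ K :=
  (norm_nonneg _).trans (hX.norm_le 0)

theorem DiffBound.of_succ (hX : DiffBound E h (n + 1) K X) : DiffBound E h n K X := by
  induction n generalizing K X with
  | zero => exact hX.1
  | succ n ih => exact ⟨hX.1, fun e he => ih (hX.2 e he)⟩

theorem DiffBound.mono (h0 : 0 ≤ h) (hX : DiffBound E h n K X) (hK : K ≤ K') :
    DiffBound E h n K' X := by
  induction n generalizing K K' X with
  | zero => exact fun x => (hX x).trans hK
  | succ n ih =>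
    exact ⟨fun x => (hX.1 x).trans hK,
      fun e he => ih (hX.2 e he) (mul_le_mul_of_nonneg_right hK h0)⟩

theorem DiffBound.congr (hX : DiffBound E h n K X) (hXX : ∀ x, X x = X' x) :
    DiffBound E h n K X' :=
  (funext hXX : X = X') ▸ hX

theorem diffBound_zero (h0 : 0 ≤ h) (hK : 0 ≤ K) : DiffBound E h n K (fun _ => (0 : V)) := by
  induction n generalizing K with
  | zero => exact fun x => by simpa using hK
  | succ n ih =>
    refine ⟨fun x => by simpa using hK, fun e _ => ?_⟩
    simpa using ih (mul_nonneg hK h0)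

theorem DiffBound.add (hX : DiffBound E h n K X) (hX' : DiffBound E h n K' X') :
    DiffBound E h n (K + K') (fun x => X x + X' x) := by
  induction n generalizing K K' X X' with
  | zero => exact fun x => norm_add_le_of_le (hX x) (hX' x)
  | succ n ih =>
    refine ⟨fun x => norm_add_le_of_le (hX.1 x) (hX'.1 x), fun e he => ?_⟩
    have := ih (hX.2 e he) (hX'.2 e he)
    rw [← add_mul] at this
    simpa only [add_sub_add_comm] using this

theorem DiffBound.smul [NormedSpace ℝ V] (hX : DiffBound E h n K X) (c : ℝ) :
    DiffBound E h n (|c| * K) (fun x => c • X x) := by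
  have hc : ∀ {K : ℝ} {v : V}, ‖v‖ ≤ K → ‖c • v‖ ≤ |c| * K := fun hv => by
    rw [norm_smul, Real.norm_eq_abs]
    exact mul_le_mul_of_nonneg_left hv (abs_nonneg c)
  induction n generalizing K X with
  | zero => exact fun x => hc (hX x)
  | succ n ih =>
    refine ⟨fun x => hc (hX.1 x), fun e he => ?_⟩
    have := ih (hX.2 e he)
    rw [← mul_assoc] at this
    simpa only [smul_sub] using this

theorem DiffBound.shift (hX : DiffBound E h n K X) (y : ι) :
    DiffBound E h n K (fun x => X (x - y)) := by
  induction n generalizing K X with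
  | zero => exact fun x => hX (x - y)
  | succ n ih =>
    refine ⟨fun x => hX.1 (x - y), fun e he => ?_⟩
    simpa only [sub_right_comm _ y e] using ih (hX.2 e he)

theorem DiffBound.comp (h0 : 0 ≤ h) {Z : ι' → V} (hZ : DiffBound E' h n K Z) (g : ι →+ ι')
    (hg : ∀ e ∈ E, g e ∈ E' ∨ g e = 0) : DiffBound E h n K (fun x => Z (g x)) := by
  induction n generalizing K Z with
  | zero => exact fun x => hZ (g x)
  | succ n ih =>
    refine ⟨fun x => hZ.1 (g x), fun e he => ?_⟩
    simp only [map_sub]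
    rcases hg e he with hge | hge
    · exact ih (hZ.2 _ hge)
    · simpa only [hge, sub_zero, sub_self] using diffBound_zero h0 (mul_nonneg hZ.nonneg h0)

theorem DiffBound.clm_apply [NormedSpace ℝ V] {W : Type*} [NormedAddCommGroup W]
    [NormedSpace ℝ W] {A : ι → V →L[ℝ] W} (hA : DiffBound E h n K A)
    (hX : DiffBound E h n K' X) : DiffBound E h n (2 ^ n * (K * K')) (fun x => A x (X x)) := by
  have hle : ∀ {K K' : ℝ} {A : V →L[ℝ] W} {v : V}, ‖A‖ ≤ K → ‖v‖ ≤ K' → ‖A v‖ ≤ K * K' :=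
    fun hA hv => ContinuousLinearMap.le_of_opNorm_le_of_le _ hA hv
  induction n generalizing K K' A X with
  | zero => exact fun x => by simpa using hle (hA x) (hX x)
  | succ n ih =>
    refine ⟨fun x => (hle (hA.1 x) (hX.1 x)).trans ?_, fun e he => ?_⟩
    · exact le_mul_of_one_le_left (mul_nonneg hA.nonneg hX.nonneg)
        (one_le_pow₀ one_le_two)
    · have := (ih (hA.2 e he) hX.of_succ).add (ih (hA.of_succ.shift e) (hX.2 e he))
      convert this using 2
      · ring
      · simp

theorem DiffBound.norm_iterate_bdiff_le {G : ℤ → V} (hG : DiffBound {1} h n K G) {s : ℕ}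
    (hs : s ≤ n) (i : ℤ) : ‖bdiff^[s] G i‖ ≤ K * h ^ s := by
  induction s generalizing n K G with
  | zero => simpa using hG.norm_le i
  | succ s ih =>
    obtain ⟨n, rfl⟩ := Nat.exists_eq_add_of_le' hs
    rw [Function.iterate_succ_apply, pow_succ', ← mul_assoc]
    exact ih (n := n + s) (hG.2 1 rfl) (by omega)

theorem diffBound_of_norm_iterate_bdiff_le {G : ℤ → V}
    (hG : ∀ s ≤ n, ∀ i, ‖bdiff^[s] G i‖ ≤ K * h ^ s) : DiffBound {1} h n K G := by
  have h0 : ∀ i, ‖G i‖ ≤ K := fun i => by simpa using hG 0 (Nat.zero_le _) i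
  induction n generalizing K G with
  | zero => exact h0
  | succ n ih =>
    refine ⟨h0, fun e he => ?_⟩
    have h1 : ∀ s ≤ n, ∀ i, ‖bdiff^[s] (bdiff G) i‖ ≤ K * h * h ^ s := fun s hs i => by
      have := hG (s + 1) (by omega) i
      rwa [pow_succ', ← mul_assoc] at this
    rw [Set.mem_singleton_iff] at he
    subst he
    exact ih h1 fun i => by simpa [bdiff] using h1 0 (Nat.zero_le _) i

end DiffBound

section Grid

variable {V : Type*} [NormedAddCommGroup V] {h : ℝ} {n : ℕ} {K : ℝ}

/-- The coordinate directions of `ℤ²`. -/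
def grid2 : Set (ℤ × ℤ) := {(1, 0), (0, 1)}

/-- The coordinate directions of `ℤ³`. -/
def grid3 : Set (ℤ × ℤ × ℤ) := {(1, 0, 0), (0, 1, 0), (0, 0, 1)}

theorem iterate_D2_D1 {L : Type*} [AddCommGroup L] (s : ℕ) (Y : ℤ → ℤ → L) :
    D2^[s] (D1 Y) = D1 (D2^[s] Y) := by
  have : Function.Commute (D2 (L := L)) D1 := fun Y => by
    funext i j
    simp only [D1, D2]
    abel
  exact this.iterate_left s Y

theorem diffBound_grid2 {Y : ℤ → ℤ → V}
    (hY : ∀ s t, s + t ≤ n → ∀ i j, ‖D1^[s] (D2^[t] Y) i j‖ ≤ K * h ^ (s + t)) :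
    DiffBound grid2 h n K (fun x => Y x.1 x.2) := by
  have h0 : ∀ x : ℤ × ℤ, ‖Y x.1 x.2‖ ≤ K := fun x => by simpa using hY 0 0 (Nat.zero_le _) x.1 x.2
  induction n generalizing K Y with
  | zero => exact h0
  | succ n ih =>
    have h1 : ∀ s t, s + t ≤ n → ∀ i j, ‖D1^[s] (D2^[t] (D1 Y)) i j‖ ≤ K * h * h ^ (s + t) :=
      fun s t hst i j => by
        have := hY (s + 1) t (by omega) i j
        rwa [Function.iterate_succ_apply, ← iterate_D2_D1, add_right_comm, pow_succ',
          ← mul_assoc] at this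
    have h2 : ∀ s t, s + t ≤ n → ∀ i j, ‖D1^[s] (D2^[t] (D2 Y)) i j‖ ≤ K * h * h ^ (s + t) :=
      fun s t hst i j => by
        have := hY s (t + 1) (by omega) i j
        rwa [← add_assoc, pow_succ', ← mul_assoc] at this
    refine ⟨h0, ?_⟩
    rintro e (rfl | rfl)
    · simpa [D1] using ih h1 fun x => by simpa using h1 0 0 (Nat.zero_le _) x.1 x.2
    · simpa [D2] using ih h2 fun x => by simpa using h2 0 0 (Nat.zero_le _) x.1 x.2

theorem diffBound_grid3_sub [NormedSpace ℝ V] (h0 : 0 ≤ h) {Y : ℤ → ℤ → V}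
    (hY : ∀ s t, s + (t + 1) ≤ n → ∀ i j,
      ‖D1^[s] (D2^[t + 1] Y) i j‖ ≤ K * h ^ (s + (t + 1)))
    (hY' : ∀ s ≤ n, ∀ i j l, ‖D1^[s] Y i j - D1^[s] Y i l‖ ≤ K * h ^ s) :
    DiffBound grid3 h n K (fun x => Y x.1 x.2.1 - Y x.1 x.2.2) := by
  have hK : ∀ x : ℤ × ℤ × ℤ, ‖Y x.1 x.2.1 - Y x.1 x.2.2‖ ≤ K := fun x => by
    simpa using hY' 0 (Nat.zero_le _) x.1 x.2.1 x.2.2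
  induction n generalizing K Y with
  | zero => exact hK
  | succ n ih =>
    have hD1 : ∀ s ≤ n, ∀ i j l, ‖D1^[s] (D1 Y) i j - D1^[s] (D1 Y) i l‖ ≤ K * h * h ^ s :=
      fun s hs i j l => by
        have := hY' (s + 1) (by omega) i j l
        rwa [pow_succ', ← mul_assoc] at this
    have hD2 : DiffBound grid2 h n (K * h) (fun x => D2 Y x.1 x.2) :=
      diffBound_grid2 fun s t hst i j => by
        have := hY s t (by omega) i j
        rwa [← add_assoc, pow_succ', ← mul_assoc] at this
    refine ⟨hK, ?_⟩
    rintro e (rfl | rfl | rfl)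
    · have := ih (Y := D1 Y) (K := K * h) (fun s t hst i j => by
        have := hY (s + 1) t (by omega) i j
        rwa [Function.iterate_succ_apply, ← iterate_D2_D1, add_right_comm, pow_succ',
          ← mul_assoc] at this) hD1 (fun x => by simpa using hD1 0 (Nat.zero_le _) x.1 x.2.1 x.2.2)
      simpa [D1, sub_sub_sub_comm] using this
    · have := hD2.comp h0 (E := grid3) ((AddMonoidHom.fst ℤ (ℤ × ℤ)).prod
        ((AddMonoidHom.fst ℤ ℤ).comp (AddMonoidHom.snd ℤ (ℤ × ℤ))))
        (by rintro e (rfl | rfl | rfl) <;> simp [grid2])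
      simpa [D2] using this
    · have := (hD2.comp h0 (E := grid3) ((AddMonoidHom.fst ℤ (ℤ × ℤ)).prod
        ((AddMonoidHom.snd ℤ ℤ).comp (AddMonoidHom.snd ℤ (ℤ × ℤ))))
        (by rintro e (rfl | rfl | rfl) <;> simp [grid2])).smul (-1)
      simpa [D2] using this

variable {β : ℤ → ℝ} {N : ℕ}

/-- Averaging the last variable with a mask of smoothing order `r ≥ n` preserves difference bounds
of order `n`. -/
theorem exists_diffBound_finsum (V : Type*) [NormedAddCommGroup V] [NormedSpace ℝ V]
    (hβ : SuppIn β N) {r : ℕ} (hr : n ≤ r) :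
    ∃ c : ℝ, 0 ≤ c ∧ ∀ (h K : ℝ) (X : ℤ × ℤ × ℤ → V), 0 ≤ h → DiffBound grid3 h n K X →
      DiffBound grid3 h n (c * K)
        (fun x => ∑ᶠ l, avgMask^[r] β (x.1 - 2 * l) • X (x.1, x.2.1, l)) := by
  have hfin : ∀ r, SuppIn (avgMask^[r] β) (N + r) := fun r => hβ.iterate_avgMask r
  obtain ⟨B, hB0, hB⟩ := (hfin r).exists_bound
  have hsup : ∀ (K : ℝ) (X : ℤ × ℤ × ℤ → V), (∀ x, ‖X x‖ ≤ K) → ∀ x : ℤ × ℤ × ℤ,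
      ‖∑ᶠ l, avgMask^[r] β (x.1 - 2 * l) • X (x.1, x.2.1, l)‖ ≤
        (2 * (N + r : ℕ) + 1) * B * K := fun K X hX x =>
    (hfin r).norm_subdiv_le (f := fun l => X (x.1, x.2.1, l)) hB (fun l => hX _) x.1
  induction n generalizing r B with
  | zero => exact ⟨_, by positivity, fun h K X _ hX => hsup K X hX⟩
  | succ n ih =>
    obtain ⟨r, rfl⟩ := Nat.exists_eq_add_of_le' (show 1 ≤ r by omega)
    obtain ⟨B', hB'0, hB'⟩ := (hfin r).exists_bound
    obtain ⟨c₁, hc₁, hT₁⟩ := ih (r := r + 1) (by omega) B hB0 hB hsup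
    obtain ⟨c₂, hc₂, hT₂⟩ := ih (r := r) (by omega) B' hB'0 hB' fun K X hX x =>
      (hfin r).norm_subdiv_le (f := fun l => X (x.1, x.2.1, l)) hB' (fun l => hX _) x.1
    have hc : 0 ≤ (2 * (N + (r + 1) : ℕ) + 1) * B := by positivity
    refine ⟨(2 * (N + (r + 1) : ℕ) + 1) * B + c₁ + c₂, by positivity, fun h K X h0 hX => ?_⟩
    have hK := hX.nonneg
    have hKh := mul_nonneg hK h0
    refine ⟨fun x => (hsup K X hX.1 x).trans ?_, ?_⟩
    · exact mul_le_mul_of_nonneg_right (by linarith) hK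
    have hsub : ∀ (X' : ℤ × ℤ × ℤ → V) (x : ℤ × ℤ × ℤ),
        (∑ᶠ l, avgMask^[r + 1] β (x.1 - 2 * l) • X (x.1, x.2.1, l)) -
          ∑ᶠ l, avgMask^[r + 1] β (x.1 - 2 * l) • X' (x.1, x.2.1, l) =
        ∑ᶠ l, avgMask^[r + 1] β (x.1 - 2 * l) • (X (x.1, x.2.1, l) - X' (x.1, x.2.1, l)) := by
      intro X' x
      simp only [smul_sub]
      exact (finsum_sub_distrib ((hfin _).finite (fun l => X (x.1, x.2.1, l)) x.1)
        ((hfin _).finite (fun l => X' (x.1, x.2.1, l)) x.1)).symm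
    rintro e (rfl | rfl | rfl)
    · have h1 := hT₁ h _ _ h0 (hX.2 (1, 0, 0) (by simp [grid3]))
      have h2 := (hT₂ h _ _ h0 ((hX.2 (0, 0, 1) (by simp [grid3])).shift (1, 0, 0))).smul 2⁻¹
      refine ((h1.add h2).mono h0 (K' := ((2 * (N + (r + 1) : ℕ) + 1) * B + c₁ + c₂) * K * h)
        ?_).congr ?_
      · rw [abs_of_pos (by norm_num)]
        nlinarith [mul_nonneg hc hKh, mul_nonneg hc₂ hKh]
      · intro x
        have h3 := (hfin r).finsum_avgMask_sub (fun l => X (x.1 - 1, x.2.1, l)) x.1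
        rw [← Function.iterate_succ_apply' avgMask] at h3
        have h4 := hsub (fun y => X (y - (1, 0, 0))) x
        simp only [Prod.mk_sub_mk, sub_zero, Prod.fst_sub, Prod.snd_sub] at h3 h4 ⊢
        rw [← h4, ← h3, sub_add_sub_cancel]
    · refine ((hT₁ h _ _ h0 (hX.2 (0, 1, 0) (by simp [grid3]))).mono h0
        (K' := ((2 * (N + (r + 1) : ℕ) + 1) * B + c₁ + c₂) * K * h) ?_).congr ?_
      · nlinarith [mul_nonneg hc hKh, mul_nonneg hc₂ hKh]
      · intro x
        have h4 := hsub (fun y => X (y - (0, 1, 0))) x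
        simp only [Prod.mk_sub_mk, sub_zero, Prod.fst_sub, Prod.snd_sub] at h4 ⊢
        rw [← h4]
    · refine (diffBound_zero h0 (by positivity)).congr fun x => ?_
      simp

end Grid

section Assembly

theorem UConv.eq_zero {V : Type*} [NormedAddCommGroup V] {u : ℕ → ℤ → V} {U : ℝ → V}
    (h : UConv u U) (hU : Continuous U) {i₀ : ℤ}
    (h0 : ∀ k t, u (k + 1) (i₀ + 2 * t) = 0) : U = 0 := by
  funext x
  have hlim : Tendsto (fun k : ℕ => ((i₀ + 2 * ⌊x * 2 ^ k⌋ : ℤ) : ℝ) / 2 ^ (k + 1)) atTop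
      (𝓝 x) := by
    have h1 : Tendsto (fun k : ℕ => (i₀ : ℝ) * (2 : ℝ)⁻¹ ^ (k + 1)) atTop (𝓝 0) := by
      simpa using ((tendsto_pow_atTop_nhds_zero_of_lt_one (r := (2 : ℝ)⁻¹)
        (by norm_num) (by norm_num)).comp (tendsto_add_atTop_nat 1)).const_mul (i₀ : ℝ)
    have h2 := h1.add (tendsto_floor_div_two_pow x)
    rw [zero_add] at h2
    refine h2.congr fun k => ?_
    push_cast
    rw [inv_pow, pow_succ]
    field_simp
  refine tendsto_nhds_unique ((hU.tendsto x).comp hlim) ?_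
  rw [Pi.zero_apply, Metric.tendsto_atTop]
  intro ε hε
  obtain ⟨K, hK⟩ := h (ε / 2) (by positivity)
  refine ⟨K, fun k hk => ?_⟩
  have := hK (k + 1) (by omega) (i₀ + 2 * ⌊x * 2 ^ k⌋)
  rw [h0, zero_sub, norm_neg] at this
  rw [dist_zero_right]
  exact this.trans_lt (by linarith)

theorem iterate_D1_sub_const {L : Type*} [AddCommGroup L] (s : ℕ) (Y : ℤ → ℤ → L) (l i j : ℤ) :
    D1^[s] (fun i' j' => Y i' j' - Y i' l) i j = D1^[s] Y i j - D1^[s] Y i l := by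
  induction s generalizing Y with
  | zero => rfl
  | succ s ih =>
    simp only [Function.iterate_succ_apply]
    rw [← ih]
    refine congrArg (fun Z => D1^[s] Z i j) (funext₂ fun i' j' => ?_)
    simp only [D1]
    abel

theorem iterate_D2_sub_const {L : Type*} [AddCommGroup L] (t : ℕ) (Y : ℤ → ℤ → L) (l : ℤ) :
    D2^[t + 1] (fun i' j' => Y i' j' - Y i' l) = D2^[t + 1] Y := by
  rw [Function.iterate_succ_apply, Function.iterate_succ_apply]
  congr 1
  funext i' j'
  simp [D2]
variable {V : Type*} [NormedAddCommGroup V] [NormedSpace ℝ V] {α β : ℤ → ℝ} {N : ℕ} {φ : ℝ → ℝ}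

/-- The deviation of the operator-weighted scheme from the linear scheme with mask `α`. -/
def deviation (α : ℤ → ℝ) (A : ℤ → ℤ → V →L[ℝ] V) (p : ℤ → V) : ℤ → V :=
  fun i => ∑ᶠ j, α (i - 2 * j) • ∑ᶠ l, α (i - 2 * l) • (A i j - A i l) (p j)

theorem SuppIn.finsum_operator_smul (hα : SuppIn α N) (A : ℤ → ℤ → V →L[ℝ] V) (p : ℤ → V)
    (i : ℤ) :
    ∑ᶠ j, α (i - 2 * j) • (1 + ∑ᶠ l, α (i - 2 * l) • (A i j - A i l)) (p j) =
      (subdiv α p + deviation α A p) i := by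
  have h1 : ∀ j, (∑ᶠ l, α (i - 2 * l) • (A i j - A i l)) (p j) =
      ∑ᶠ l, α (i - 2 * l) • (A i j - A i l) (p j) := fun j => by
    simpa using (ContinuousLinearMap.apply ℝ V (p j)).toLinearMap.toAddMonoidHom.map_finsum
      (hα.finite (fun l => A i j - A i l) i)
  simp only [add_apply, one_apply_eq_self, h1, smul_add]
  exact finsum_add_distrib (hα.finite p i)
    (hα.finite (fun j => ∑ᶠ l, α (i - 2 * l) • (A i j - A i l) (p j)) i)

theorem exists_norm_deviation_le (V : Type*) [NormedAddCommGroup V] [NormedSpace ℝ V]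
    (hα : SuppIn α N) :
    ∃ c : ℝ, 0 ≤ c ∧ ∀ (K Q : ℝ) (A : ℤ → ℤ → V →L[ℝ] V) (p : ℤ → V), 0 ≤ K →
      (∀ i j l, α (i - 2 * l) ≠ 0 → ‖A i j - A i l‖ ≤ K) → (∀ i, ‖p i‖ ≤ Q) →
      ∀ i, ‖deviation α A p i‖ ≤ c * (K * Q) := by
  obtain ⟨B, hB0, hB⟩ := hα.exists_bound
  refine ⟨((2 * N + 1) * B) * ((2 * N + 1) * B), by positivity, fun K Q A p hK hA hp i => ?_⟩
  have hQ : 0 ≤ Q := (norm_nonneg _).trans (hp 0)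
  rw [mul_assoc]
  refine hα.norm_subdiv_le hB (fun j => ?_) i
  have h1 : ∀ l, α (i - 2 * l) • (A i j - A i l) (p j) =
      α (i - 2 * l) • if α (i - 2 * l) = 0 then 0 else (A i j - A i l) (p j) := fun l => by
    split_ifs with hl
    · rw [hl, zero_smul, zero_smul]
    · rfl
  simp only [h1]
  refine hα.norm_subdiv_le
    (f := fun l => if α (i - 2 * l) = 0 then 0 else (A i j - A i l) (p j)) hB (fun l => ?_) i
  split_ifs with hl
  · rw [norm_zero]
    positivity
  · exact ContinuousLinearMap.le_of_opNorm_le_of_le _ (hA i j l hl) (hp j)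

theorem exists_diffBound_deviation (V : Type*) [NormedAddCommGroup V] [NormedSpace ℝ V]
    (hβ : SuppIn β N) (m : ℕ) :
    ∃ c : ℝ, 0 ≤ c ∧ ∀ (h K Q : ℝ) (A : ℤ → ℤ → V →L[ℝ] V) (p : ℤ → V), 0 ≤ h →
      DiffBound grid3 h m K (fun x => A x.1 x.2.1 - A x.1 x.2.2) → DiffBound {1} h m Q p →
      DiffBound {1} h m (c * (K * Q)) (deviation (avgMask^[m] β) A p) := by
  obtain ⟨c, hc, hT⟩ := exists_diffBound_finsum V hβ (le_refl m)
  refine ⟨c * c * 2 ^ m, by positivity, fun h K Q A p h0 hA hp => ?_⟩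
  have hp' := hp.comp h0 (E := grid3)
    ((AddMonoidHom.fst ℤ ℤ).comp (AddMonoidHom.snd ℤ (ℤ × ℤ)))
    (by rintro e (rfl | rfl | rfl) <;> simp)
  have h1 := (hT h _ _ h0 (hA.clm_apply hp')).comp h0 (E := grid3)
    ((AddMonoidHom.fst ℤ (ℤ × ℤ)).prod
      (((AddMonoidHom.snd ℤ ℤ).comp (AddMonoidHom.snd ℤ (ℤ × ℤ))).prod
        ((AddMonoidHom.fst ℤ ℤ).comp (AddMonoidHom.snd ℤ (ℤ × ℤ)))))
    (by rintro e (rfl | rfl | rfl) <;> simp [grid3])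
  have h2 := (hT h _ _ h0 h1).comp h0 (E := {1}) (AddMonoidHom.inl ℤ (ℤ × ℤ))
    (by rintro e rfl; left; left; rfl)
  rw [show c * c * 2 ^ m * (K * Q) = c * (c * (2 ^ m * (K * Q))) by ring]
  exact h2

theorem diffBound_grid3_sub_of_mask {h K : ℝ} (h0 : 0 ≤ h) {m : ℕ} {Y : ℤ → ℤ → V}
    (hα : ∀ i, ∃ l, α (i - 2 * l) ≠ 0)
    (hY : ∀ s t, s + t ≤ m → ∀ i j l, α (i - 2 * l) ≠ 0 →
      ‖D1^[s] (D2^[t] (fun i' j' => Y i' j' - Y i' l)) i j‖ ≤ K * h ^ (s + t)) :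
    DiffBound grid3 h m (2 * K) (fun x => Y x.1 x.2.1 - Y x.1 x.2.2) := by
  refine diffBound_grid3_sub h0 (fun s t hst i j => ?_) fun s hs i j l => ?_
  · obtain ⟨l, hl⟩ := hα i
    have h1 := hY s (t + 1) hst i j l hl
    rw [iterate_D2_sub_const] at h1
    linarith [norm_nonneg (D1^[s] (D2^[t + 1] Y) i j)]
  · obtain ⟨l', hl'⟩ := hα i
    have h1 := hY s 0 hs i j l' hl'
    have h2 := hY s 0 hs i l l' hl'
    simp only [Function.iterate_zero, id_eq, iterate_D1_sub_const, add_zero] at h1 h2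
    rw [norm_sub_rev] at h2
    linarith [norm_sub_le_norm_sub_add_norm_sub (D1^[s] Y i j) (D1^[s] Y i l') (D1^[s] Y i l)]

theorem exists_contDiff_limit_of_deviation [CompleteSpace V] (hβ : SuppIn β N)
    (hφ : Continuous φ) (h : UConv (kernel β) φ) {m : ℕ} (hα : α = avgMask^[m] β)
    {A : ℕ → ℤ → ℤ → V →L[ℝ] V} {c C γ : ℝ} (hc : 0 < c) (hγ0 : 0 < γ) (hγ1 : γ < 1)
    (hA : ∀ s t, s + t ≤ m → ∀ k i j l, α (i - 2 * l) ≠ 0 →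
      ‖D1^[s] (D2^[t] (fun i' j' => A k i' j' - A k i' l)) i j‖ ≤
        c * (2 : ℝ)⁻¹ ^ ((s + t) * k) * γ ^ k)
    {p : ℕ → ℤ → V} (hp0 : ∀ i, ‖p 0 i‖ ≤ C)
    (hp : ∀ k, p (k + 1) = subdiv α (p k) + deviation α (A k) (p k)) :
    ∃ P : ℝ → V, ContDiff ℝ m P ∧ UConv p P := by
  subst hα
  by_cases hα : ∀ i : ℤ, ∃ l, avgMask^[m] β (i - 2 * l) ≠ 0
  · obtain ⟨c', hc', hdev⟩ := exists_diffBound_deviation V hβ m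
    refine exists_contDiff_limit_of_perturbation hβ hφ h le_rfl hp
      (B := c' * (2 * c)) (by positivity) hγ0 hγ1 hp0 fun k Y hY s hs i => ?_
    have h1 : DiffBound grid3 ((2 : ℝ)⁻¹ ^ k) m (2 * (c * γ ^ k))
        (fun x => A k x.1 x.2.1 - A k x.1 x.2.2) :=
      diffBound_grid3_sub_of_mask (by positivity) hα fun s t hst i j l hl => by
        refine (hA s t hst k i j l hl).trans_eq ?_
        rw [← pow_mul, mul_comm k]
        ring
    refine ((hdev _ _ _ (A k) (p k) (by positivity) h1
      (diffBound_of_norm_iterate_bdiff_le hY)).norm_iterate_bdiff_le hs i).trans_eq ?_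
    ring
  · push Not at hα
    obtain ⟨i₀, hi₀⟩ := hα
    obtain ⟨c', hc', hdev⟩ := exists_norm_deviation_le V (hβ.iterate_avgMask m)
    obtain ⟨P, hP, hPu⟩ := exists_contDiff_limit_of_perturbation hβ hφ h (Nat.zero_le m) hp
      (B := c' * c) (by positivity) hγ0 hγ1 hp0 fun k Y hY s hs i => by
        obtain rfl : s = 0 := by omega
        have h1 := hdev (c * γ ^ k) Y (A k) (p k) (by positivity)
          (fun i j l hl => by simpa using hA 0 0 (Nat.zero_le _) k i j l hl)
          (fun i => by simpa using hY 0 le_rfl i) i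
        simp only [Function.iterate_zero, id_eq, pow_zero, mul_one]
        exact h1.trans_eq (by ring)
    have hzero : P = 0 := hPu.eq_zero hP.continuous (i₀ := i₀) fun k t => by
      have h1 : ∀ l, avgMask^[m] β (i₀ + 2 * t - 2 * l) = 0 := fun l => by
        rw [← hi₀ (l - t), mul_sub]
        abel_nf
      rw [hp]
      simp [subdiv, deviation, h1]
    exact ⟨P, hzero ▸ contDiff_const, hPu⟩

theorem SuppIn.exists_kernel_limit {d : ℕ} (hβ : SuppIn β N)
    {e : EuclideanSpace ℝ (Fin d)} (he : ‖e‖ = 1)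
    (hconv : ∀ f0 : ℤ → EuclideanSpace ℝ (Fin d), (∃ C : ℝ, ∀ i : ℤ, ‖f0 i‖ ≤ C) →
      ∃ F : ℝ → EuclideanSpace ℝ (Fin d), Continuous F ∧ UConv (fun k => (Sop β)^[k] f0) F) :
    ∃ φ : ℝ → ℝ, Continuous φ ∧ UConv (kernel β) φ := by
  obtain ⟨F, hF, hFu⟩ := hconv (fun i => if i = 0 then e else 0) ⟨1, fun i => by
    split_ifs <;> simp [he]⟩
  refine ⟨fun x => ⟪e, F x⟫, by fun_prop, fun ε hε => ?_⟩
  obtain ⟨K, hK⟩ := hFu ε hε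
  refine ⟨K, fun k hk i => ?_⟩
  have h1 : (Sop β)^[k] (fun i => if i = 0 then e else 0) i = kernel β k i • e := by
    refine (hβ.iterate_subdiv_apply k _ i).trans ?_
    rw [finsum_eq_single _ 0 fun l hl => by simp [hl]]
    simp
  have h2 := hK k hk i
  dsimp only at h2 ⊢
  rw [h1] at h2
  have h3 : kernel β k i - ⟪e, F ((i : ℝ) / 2 ^ k)⟫ =
      ⟪e, kernel β k i • e - F ((i : ℝ) / 2 ^ k)⟫ := by
    rw [inner_sub_right, inner_smul_right, real_inner_self_eq_norm_sq, he]
    ring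
  rw [h3]
  refine (norm_inner_le_norm _ _).trans ?_
  rwa [he, one_mul]

theorem exists_suppIn (hβ : (Function.support β).Finite) : ∃ N, SuppIn β N := by
  obtain ⟨N, hN⟩ := (hβ.image Int.natAbs).bddAbove
  refine ⟨N, fun t ht => ?_⟩
  by_contra hne
  have := hN ⟨t, hne, rfl⟩
  rw [Int.abs_eq_natAbs] at ht
  omega

end Assembly

end PNSubdivision

/-- Smoothness of univariate PN subdivision (Theorem 2).  If the symbol
of `a` factors as `a(z) = ((1+z)/2)^m b(z)` with `S_b` convergent (`C⁰`), the
subdivided unit normals have nonnegative inner products on the support of the mask,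
and the mixed differences of the families `(i,j) ↦ A_{ij}^k − A_{il}^k` of orders
`s₁ + s₂ ≤ m` satisfy the bounds `c_s 2^{−(s₁+s₂)k} γ^k`, then for every bounded
initial sequence the PN subdivision sequence `p_i^{k+1} = Σ_j a_{i−2j} M_{ij}^k p_j^k`
converges uniformly to a `C^m` limit curve. -/
theorem pn_univariate_smoothness
    (m : ℕ) (a b : ℤ → ℝ)
    (hb : (Function.support b).Finite)
    (hab : ∀ i : ℤ, a i = (2 : ℝ)⁻¹ ^ m *
      ∑ r ∈ Finset.range (m + 1), (m.choose r : ℝ) * b (i - (r : ℤ)))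
    (hconv : ∀ f0 : ℤ → EuclideanSpace ℝ (Fin d), (∃ C : ℝ, ∀ i : ℤ, ‖f0 i‖ ≤ C) →
      ∃ F : ℝ → EuclideanSpace ℝ (Fin d), Continuous F ∧
        ∀ ε > (0 : ℝ), ∃ K : ℕ, ∀ k ≥ K, ∀ i : ℤ,
          ‖(Sop b)^[k] f0 i - F ((i : ℝ) / 2 ^ k)‖ ≤ ε)
    (n : ℕ → ℤ → EuclideanSpace ℝ (Fin d))
    (hunit : ∀ (k : ℕ) (j : ℤ), ‖n k j‖ = 1)
    (hinner : ∀ (k : ℕ) (i j : ℤ), a (i - 2 * j) ≠ 0 → 0 ≤ ⟪n (k + 1) i, n k j⟫)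
    (c_s γ : ℝ) (hc : 0 < c_s) (hγ₀ : 0 < γ) (hγ₁ : γ < 1)
    (hA : ∀ s₁ s₂ : ℕ, s₁ + s₂ ≤ m → ∀ (k : ℕ) (i j l : ℤ), a (i - 2 * l) ≠ 0 →
      ‖(D1^[s₁] (D2^[s₂] (fun i' j' => pnA n k i' j' - pnA n k i' l))) i j‖
        ≤ c_s * (2 : ℝ)⁻¹ ^ ((s₁ + s₂) * k) * γ ^ k)
    (p : ℕ → ℤ → EuclideanSpace ℝ (Fin d))
    (hbdd : ∃ C : ℝ, ∀ i : ℤ, ‖p 0 i‖ ≤ C)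
    (hrec : ∀ (k : ℕ) (i : ℤ),
      p (k + 1) i = ∑ᶠ j : ℤ, a (i - 2 * j) • pnM a n k i j (p k j)) :
    ∃ P : ℝ → EuclideanSpace ℝ (Fin d), ContDiff ℝ m P ∧
      ∀ ε > (0 : ℝ), ∃ K : ℕ, ∀ k ≥ K, ∀ i : ℤ,
        ‖p k i - P ((i : ℝ) / 2 ^ k)‖ ≤ ε := by
  obtain ⟨N, hN⟩ := PNSubdivision.exists_suppIn hb
  obtain ⟨φ, hφ, hφu⟩ := hN.exists_kernel_limit (hunit 0 0) hconv
  obtain ⟨C, hC⟩ := hbdd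
  have ha : a = PNSubdivision.avgMask^[m] b := funext fun i => by
    rw [hab, PNSubdivision.iterate_avgMask_apply]
  refine PNSubdivision.exists_contDiff_limit_of_deviation hN hφ hφu ha (A := pnA n) hc hγ₀ hγ₁
    hA hC fun k => funext fun i => ?_
  rw [hrec]
  exact (ha ▸ hN.iterate_avgMask m).finsum_operator_smul (pnA n k) (p k) i
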